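/- arXiv:math/0609114 — 10 statements merged into one kernel-verified Lean document; each statement's English description precedes it below -/
import Mathlib

section
/- Every loc-lattice is representable as a lattice of intervals. That is, if L is a loc-lattice with least element 0, then there exist a linearly ordered set (X, ≤) and a map f from L to the subsets of X such that: f is an order embedding (a ≼ b if and only if f(a) ⊆ f(b)), every f(a) is a convex subset of (X, ≤), f(0) = ∅, and f(a ⊓ b) = f(a) ∩ f(b) for all a, b ∈ L. -/
universe u

/-- A loc-lattice: a lattice with least element satisfying the three conditions of
Definition 1.1 of the paper. -/
def LocLattice (L : Type u) [Lattice L] [OrderBot L] : Prop :=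
  (∀ a b c : L, a ≤ b ⊔ c ∨ b ≤ a ⊔ c ∨ c ≤ a ⊔ b) ∧
  (∀ a b x : L, (¬ a ≤ b ∧ ¬ b ≤ a) → (¬ a ≤ x ∧ ¬ x ≤ a) → (¬ b ≤ x ∧ ¬ x ≤ b) →
    x ≤ a ⊔ b → (a ⊔ x) ⊓ (b ⊔ x) = x) ∧
  (∀ a b x : L, x ≤ a ⊔ b → a ⊓ x ≠ ⊥ → b ⊓ x ≠ ⊥ → (a ⊓ x) ⊔ (b ⊓ x) = x)

/-- A filter of a lattice: a nonempty proper subset, upward closed and closed under meets. -/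
def IsLatFilter {L : Type u} [Lattice L] (F : Set L) : Prop :=
  F.Nonempty ∧ F ≠ Set.univ ∧ (∀ a ∈ F, ∀ b : L, a ≤ b → b ∈ F) ∧
    ∀ a ∈ F, ∀ b ∈ F, a ⊓ b ∈ F

/-- `Ibar a b` : the internal elements of `a, b` together with `a` and `b`. -/
def Ibar {L : Type u} [Lattice L] (a b : L) : Set L :=
  {x | x ≤ a ⊔ b ∧ (a ⊓ x) ⊔ (b ⊓ x) ≠ x} ∪ {a, b}

/-- A semi-prime filter. -/
def IsSemiPrimeFilter {L : Type u} [Lattice L] (F : Set L) : Prop :=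
  IsLatFilter F ∧ ∀ a b : L, a ⊔ b ∈ F → (Ibar a b ∩ F).Nonempty

/-- A lattice is well separated if for every semi-prime filter `F` and every `x ∉ F`
there is `y ∈ F` with `¬ x ≤ y`. -/
def WellSeparatedLat (L : Type u) [Lattice L] : Prop :=
  ∀ F : Set L, IsSemiPrimeFilter F → ∀ x : L, x ∉ F → ∃ y ∈ F, ¬ x ≤ y

/-- Convexity of a set with respect to a relation `le`. -/
def RelConvex {X : Type u} (le : X → X → Prop) (S : Set X) : Prop :=
  ∀ a b c : X, a ∈ S → c ∈ S → le a b → le b c → b ∈ S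

local notation:50 a " ∥ " b => IncompRel (· ≤ ·) a b

section Betweenness

theorem incompRel_of_le_sup {L : Type u} [Lattice L] {x y z : L} (hx : x ∥ z)
    (hy : y ∥ z) (hz : z ≤ x ⊔ y) : x ∥ y := by
  constructor
  · intro hxy
    rw [sup_eq_right.2 hxy] at hz
    exact hy.2 hz
  · intro hxy
    rw [sup_eq_left.2 hxy] at hz
    exact hx.2 hz

variable {L : Type u} [Lattice L] [OrderBot L]

theorem LocLattice.inf_sup_eq_of_between (h : LocLattice L) {a b x : L} (hab : a ∥ b)
    (hax : a ∥ x) (hbx : b ∥ x) (hx : x ≤ a ⊔ b) : (a ⊔ x) ⊓ (b ⊔ x) = x :=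
  h.2.1 a b x hab hax hbx hx

/-- Of three pairwise incomparable elements, at most one lies between the other two. -/
theorem LocLattice.not_between_of_between (h : LocLattice L) {a b x : L} (hab : a ∥ b)
    (hax : a ∥ x) (hbx : b ∥ x) (hx : x ≤ a ⊔ b) : ¬ b ≤ a ⊔ x := fun hb => by
  have key := h.inf_sup_eq_of_between hab hax hbx hx
  have : b ≤ x := key ▸ le_inf hb le_sup_left
  exact hbx.1 this

theorem LocLattice.not_le_sup_of_le (h : LocLattice L) {x y z w : L} (hx : x ∥ z) (hy : y ∥ z)
    (hw : w ∥ z) (hz : z ≤ x ⊔ y) (hwx : w ≤ x) : z ≤ y ⊔ w := by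
  have hxy := incompRel_of_le_sup hx hy hz
  have key := h.inf_sup_eq_of_between hxy hx hy hz
  have hnw : ¬ w ≤ y ⊔ z := fun hle => hw.1 (key ▸ le_inf (hwx.trans le_sup_left) hle)
  rcases h.1 w z y with h1 | h1 | h1
  · exact absurd (h1.trans_eq (sup_comm _ _)) hnw
  · exact h1.trans_eq (sup_comm _ _)
  · exact absurd (h1.trans (sup_le_sup_right hwx z))
      (h.not_between_of_between hxy hx hy hz)

theorem LocLattice.le_sup_or_le_sup (h : LocLattice L) {x y z w : L} (hx : x ∥ z) (hy : y ∥ z)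
    (hw : w ∥ z) (hz : z ≤ x ⊔ y) : z ≤ x ⊔ w ∨ z ≤ y ⊔ w := by
  have hxy := incompRel_of_le_sup hx hy hz
  have key := h.inf_sup_eq_of_between hxy hx hy hz
  have hny : ¬ y ≤ x ⊔ z := h.not_between_of_between hxy hx hy hz
  have hnx : ¬ x ≤ y ⊔ z :=
    h.not_between_of_between hxy.symm hy hx (hz.trans_eq (sup_comm _ _))
  by_cases hwx : w ≤ x
  · exact Or.inr (h.not_le_sup_of_le hx hy hw hz hwx)
  by_cases hwy : w ≤ y
  · exact Or.inl (h.not_le_sup_of_le hy hx hw (hz.trans_eq (sup_comm _ _)) hwy)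
  by_contra! hcon
  obtain ⟨hzx, hzy⟩ := hcon
  have hxw : ¬ x ≤ y ⊔ w := fun hle => hzy (hz.trans (sup_le hle le_sup_left))
  have hyw : ¬ y ≤ x ⊔ w := fun hle => hzx (hz.trans (sup_le le_sup_left hle))
  have hw' : w ≤ x ⊔ y := by
    rcases h.1 w x y with h1 | h1 | h1
    · exact h1
    · exact absurd (h1.trans_eq (sup_comm _ _)) hxw
    · exact absurd (h1.trans_eq (sup_comm _ _)) hyw
  have hcx : w ≤ x ⊔ z ∨ x ≤ w ⊔ z := by
    rcases h.1 w x z with h1 | h1 | h1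
    exacts [Or.inl h1, Or.inr h1, absurd (h1.trans_eq (sup_comm _ _)) hzx]
  have hcy : w ≤ y ⊔ z ∨ y ≤ w ⊔ z := by
    rcases h.1 w y z with h1 | h1 | h1
    exacts [Or.inl h1, Or.inr h1, absurd (h1.trans_eq (sup_comm _ _)) hzy]
  rcases hcx with hcx | hcx <;> rcases hcy with hcy | hcy
  · exact hw.1 (key ▸ le_inf hcx hcy)
  · exact hny (hcy.trans (sup_le hcx le_sup_right))
  · exact hnx (hcx.trans (sup_le hcy le_sup_right))
  · have hwu : ¬ w ≤ x ⊔ z := fun hle => hny (hcy.trans (sup_le hle le_sup_right))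
    refine h.not_between_of_between (a := x ⊔ z) (b := w) (x := y)
      ⟨fun hle => hzx ((le_sup_right.trans hle).trans le_sup_right), hwu⟩
      ⟨fun hle => hxy.1 (le_sup_left.trans hle), hny⟩
      ⟨hwy, fun hle => hyw (hle.trans le_sup_right)⟩ ?_ ?_
    · exact hcy.trans (sup_le le_sup_right (le_sup_right.trans le_sup_left))
    · exact hw'.trans (sup_le (le_sup_left.trans le_sup_left) le_sup_right)

theorem LocLattice.not_le_sup_of_le_sup (h : LocLattice L) {x y z w : L} (hx : x ∥ z)
    (hy : y ∥ z) (hw : w ∥ z) (hzx : z ≤ x ⊔ w) (hzy : z ≤ y ⊔ w) : ¬ z ≤ x ⊔ y := fun hz => by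
  have middle : ∀ {p q r : L}, (p ∥ z) → (q ∥ z) → (r ∥ z) → z ≤ p ⊔ q → z ≤ q ⊔ r →
      z ≤ p ⊔ r → ¬ q ≤ p ⊔ r := fun {p q r} hp hq hr hpq hqr hpr hle => hq.2 <| by
    rw [← h.inf_sup_eq_of_between (incompRel_of_le_sup hp hr hpr)
      (incompRel_of_le_sup hp hq hpq) (incompRel_of_le_sup hq hr hqr).symm hle]
    exact le_inf hpq (hqr.trans_eq (sup_comm _ _))
  rcases h.1 x y w with h1 | h1 | h1
  · exact middle hy hx hw (hz.trans_eq (sup_comm _ _)) hzx hzy h1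
  · exact middle hx hy hw hz hzy hzx h1
  · exact middle hx hw hy hzx (hzy.trans_eq (sup_comm _ _)) hz h1

/-- The elements incomparable with `v` lie on two sides of `v`. -/
theorem LocLattice.exists_side (h : LocLattice L) : ∃ t : L → L → Bool,
    ∀ v u w : L, (u ∥ v) → (w ∥ v) → (t v u = t v w ↔ ¬ v ≤ u ⊔ w) := by
  classical
  have hone : ∀ v : L, ∃ s : L → Bool,
      ∀ u w : L, (u ∥ v) → (w ∥ v) → (s u = s w ↔ ¬ v ≤ u ⊔ w) := by
    intro v
    by_cases hv : ∃ r : L, r ∥ v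
    · obtain ⟨r, hr⟩ := hv
      refine ⟨fun u => decide (v ≤ u ⊔ r), fun u w hu hw => ?_⟩
      have h1 := h.le_sup_or_le_sup hu hw hr
      have h2 := h.not_le_sup_of_le_sup hu hw hr
      have h3 := h.le_sup_or_le_sup hu hr hw
      have h4 := h.le_sup_or_le_sup hw hr hu
      rw [decide_eq_decide]
      rw [sup_comm r w] at h3
      rw [sup_comm r u, sup_comm w u] at h4
      tauto
    · exact ⟨fun _ => true, fun u _ hu => absurd ⟨u, hu⟩ hv⟩
  choose t ht using hone
  exact ⟨t, ht⟩

end Betweenness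

section Orientation

theorem SimpleGraph.Walk.exists_getVert_getVert {V : Type*} {G : SimpleGraph V} {x y : V}
    (w : G.Walk x y) {i j : ℕ} (hij : i ≤ j) (hj : j ≤ w.length) :
    ∃ s : G.Walk (w.getVert i) (w.getVert j), s.length = j - i := by
  induction j, hij using Nat.le_induction with
  | base => exact ⟨.nil, by simp⟩
  | succ j hij ih =>
    obtain ⟨s, hs⟩ := ih (by omega)
    exact ⟨s.concat (w.adj_getVert_succ (by omega)), by simp [hs]; omega⟩

variable {L : Type u} [Lattice L]

/-- For a choice `t` of a numbering of the sides of each element, the double cover of the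
incomparability graph whose vertices are the elements together with a choice of direction. -/
def sideGraph (t : L → L → Bool) : SimpleGraph (L × Bool) where
  Adj p q := (p.1 ∥ q.1) ∧ (p.2 ^^ t p.1 q.1) ≠ (q.2 ^^ t q.1 p.1)
  symm := ⟨fun _ _ hpq => ⟨hpq.1.symm, hpq.2.symm⟩⟩
  loopless := ⟨fun _ hp => hp.2 rfl⟩

variable {t : L → L → Bool}

theorem sideGraph_adj_not {v u : L} {a b : Bool} (huv : (sideGraph t).Adj (v, a) (u, b)) :
    (sideGraph t).Adj (v, !a) (u, !b) := by
  refine ⟨huv.1, ?_⟩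
  have := huv.2
  revert this
  cases a <;> cases b <;> simp

theorem sideGraph_adj_or {v u : L} (huv : v ∥ u) (a b : Bool) :
    (sideGraph t).Adj (v, a) (u, b) ∨ (sideGraph t).Adj (v, !a) (u, b) := by
  by_cases hab : (a ^^ t v u) = (b ^^ t u v)
  · refine Or.inr ⟨huv, ?_⟩
    simp only [← hab]
    cases a <;> simp
  · exact Or.inl ⟨huv, hab⟩

theorem sideGraph_reachable_not {p q : L × Bool} (hpq : (sideGraph t).Reachable p q) :
    (sideGraph t).Reachable (p.1, !p.2) (q.1, !q.2) := by
  obtain ⟨w⟩ := hpq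
  induction w with
  | nil => rfl
  | cons huv _ ih => exact (sideGraph_adj_not huv).reachable.trans ih

theorem sideGraph_not_two_cycle {a b : L} {i j : Bool} (e₀ : (sideGraph t).Adj (a, i) (b, j))
    (e₁ : (sideGraph t).Adj (b, j) (a, !i)) : False := by
  have hparity : ∀ i j x y : Bool, (i ^^ x) ≠ (j ^^ y) → ¬ (j ^^ y) ≠ (!i ^^ x) := by decide
  exact hparity _ _ _ _ e₀.2 e₁.2

theorem sideGraph_not_four_cycle
    (ht : ∀ v u w : L, (u ∥ v) → (w ∥ v) → (u ≤ w ∨ w ≤ u) → t v u = t v w) {a b c d : L}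
    {i j k l : Bool} (hac : a ≤ c ∨ c ≤ a) (hbd : b ≤ d ∨ d ≤ b)
    (e₀ : (sideGraph t).Adj (a, i) (b, j)) (e₁ : (sideGraph t).Adj (b, j) (c, k))
    (e₂ : (sideGraph t).Adj (c, k) (d, l)) (e₃ : (sideGraph t).Adj (d, l) (a, !i)) : False := by
  have hparity : ∀ i j k l x y z w : Bool, (i ^^ x) ≠ (j ^^ y) → (j ^^ y) ≠ (k ^^ z) →
      (k ^^ z) ≠ (l ^^ w) → ¬ (l ^^ w) ≠ (!i ^^ x) := by decide
  have f₀ := e₀.2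
  have f₁ := e₁.2
  have f₂ := e₂.2
  have f₃ := e₃.2
  simp only [← ht b a c e₀.1 e₁.1.symm hac, ht c d b e₂.1.symm e₁.1 hbd.symm,
    ← ht d a c e₃.1.symm e₂.1 hac, ← ht a b d e₀.1.symm e₃.1 hbd] at f₀ f₁ f₂ f₃
  exact hparity _ _ _ _ _ _ _ _ f₀ f₁ f₂ f₃

variable [OrderBot L]

theorem LocLattice.side_triangle (h : LocLattice L)
    (ht : ∀ v u w : L, (u ∥ v) → (w ∥ v) → (t v u = t v w ↔ ¬ v ≤ u ⊔ w)) {a b c : L}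
    (hab : a ∥ b) (hbc : b ∥ c) (hac : a ∥ c) :
    (t a b ^^ t a c ^^ t b a ^^ t b c ^^ t c a ^^ t c b) = true := by
  have ha := ht a b c hab.symm hac.symm
  have hb := ht b a c hab hbc.symm
  have hc := ht c a b hac hbc
  have h0 := h.1 a b c
  have h2 := h.not_between_of_between hac hab hbc.symm
  have h3 := h.not_between_of_between hbc hab.symm hac.symm
  have h4 := h.not_between_of_between hbc.symm hac.symm hab.symm
  rw [sup_comm b a] at h3
  rw [sup_comm c a, sup_comm c b] at h4
  have hparity : ∀ x₁ x₂ x₃ x₄ x₅ x₆ : Bool,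
      (x₁ ≠ x₂ ∨ x₃ ≠ x₄ ∨ x₅ ≠ x₆) → (x₁ ≠ x₂ → x₃ = x₄ ∧ x₅ = x₆) →
      (x₃ ≠ x₄ → x₅ = x₆) → (x₁ ^^ x₂ ^^ x₃ ^^ x₄ ^^ x₅ ^^ x₆) = true := by decide
  refine hparity _ _ _ _ _ _ ?_ (fun hn => ?_) fun hn => hc.2 (h2 (not_not.1 (mt hb.2 hn)))
  · exact h0.imp (fun hle e => ha.1 e hle) (Or.imp (fun hle e => hb.1 e hle)
      fun hle e => hc.1 e hle)
  · have hle := not_not.1 (mt ha.2 hn)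
    exact ⟨hb.2 (h4 hle), hc.2 (h3 hle)⟩

theorem LocLattice.sideGraph_not_three_cycle (h : LocLattice L)
    (ht : ∀ v u w : L, (u ∥ v) → (w ∥ v) → (t v u = t v w ↔ ¬ v ≤ u ⊔ w)) {a b c : L}
    {i j k : Bool} (e₀ : (sideGraph t).Adj (a, i) (b, j)) (e₁ : (sideGraph t).Adj (b, j) (c, k))
    (e₂ : (sideGraph t).Adj (c, k) (a, !i)) : False := by
  have hparity : ∀ i j k x₁ x₂ x₃ x₄ x₅ x₆ : Bool,
      (x₁ ^^ x₂ ^^ x₃ ^^ x₄ ^^ x₅ ^^ x₆) = true → (i ^^ x₁) ≠ (j ^^ x₃) →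
      (j ^^ x₄) ≠ (k ^^ x₆) → ¬ (k ^^ x₅) ≠ (!i ^^ x₂) := by decide
  exact hparity _ _ _ _ _ _ _ _ _ (h.side_triangle ht e₀.1 e₁.1 e₂.1.symm) e₀.2 e₁.2 e₂.2

theorem LocLattice.not_reachable_not (h : LocLattice L)
    (ht : ∀ v u w : L, (u ∥ v) → (w ∥ v) → (t v u = t v w ↔ ¬ v ≤ u ⊔ w)) (p : L × Bool) :
    ¬ (sideGraph t).Reachable p (p.1, !p.2) := by
  classical
  rintro ⟨w₀⟩
  have hex : ∃ (n : ℕ) (q : L × Bool) (w : (sideGraph t).Walk q (q.1, !q.2)), w.length = n :=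
    ⟨_, p, w₀, rfl⟩
  obtain ⟨q, w, hw⟩ := Nat.find_spec hex
  set n := Nat.find hex with hn
  have hmin : ∀ (q : L × Bool) (w : (sideGraph t).Walk q (q.1, !q.2)), n ≤ w.length :=
    fun q w => Nat.find_min' hex ⟨q, w, rfl⟩
  clear_value n
  have hcomp : ∀ u v w : L, (u ∥ v) → (w ∥ v) → u ≤ w → t v u = t v w := fun u v w hu hw huw =>
    (ht v u w hu hw).2 fun hle => hw.2 (hle.trans_eq (sup_eq_right.2 huw))
  have hadj : ∀ i < n, (sideGraph t).Adj (w.getVert i) (w.getVert (i + 1)) := fun i hi =>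
    w.adj_getVert_succ (hw ▸ hi)
  have h0 : w.getVert 0 = q := w.getVert_zero
  have hlast : w.getVert n = (q.1, !q.2) := by rw [← hw]; exact w.getVert_length
  have hchord : ∀ i k, 2 ≤ k → k + 1 < n → i + k ≤ n →
      (w.getVert i).1 ≤ (w.getVert (i + k)).1 ∨ (w.getVert (i + k)).1 ≤ (w.getVert i).1 := by
    intro i k hk hkn hik
    by_contra! hcon
    have hinc : (w.getVert i).1 ∥ (w.getVert (i + k)).1 := hcon
    obtain ⟨s, hs⟩ := w.exists_getVert_getVert (i := i) (j := i + k) (by omega) (by omega)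
    obtain ⟨s₁, hs₁⟩ := w.exists_getVert_getVert (i := 0) (j := i) (by omega) (by omega)
    obtain ⟨s₂, hs₂⟩ := w.exists_getVert_getVert (i := i + k) (j := n) (by omega) (by omega)
    rcases sideGraph_adj_or (t := t) hinc (w.getVert i).2 (w.getVert (i + k)).2 with hA | hA
    · have := hmin q (((s₁.concat hA).append s₂).copy h0 hlast)
      simp only [SimpleGraph.Walk.length_copy, SimpleGraph.Walk.length_append,
        SimpleGraph.Walk.length_concat, hs₁, hs₂] at this
      omega
    · have := hmin (w.getVert i) (s.concat hA.symm)
      rw [SimpleGraph.Walk.length_concat, hs] at this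
      omega
  rcases lt_or_ge n 5 with hn5 | hn5
  · interval_cases n
    · rw [h0] at hlast
      have := congrArg Prod.snd hlast
      simp at this
    · have := (hadj 0 (by omega)).1
      rw [h0, hlast] at this
      exact this.1 le_rfl
    · have e₀ := hadj 0 (by omega)
      have e₁ := hadj 1 (by omega)
      rw [h0] at e₀
      rw [hlast] at e₁
      exact sideGraph_not_two_cycle e₀ e₁
    · have e₀ := hadj 0 (by omega)
      have e₂ := hadj 2 (by omega)
      rw [h0] at e₀
      rw [hlast] at e₂
      exact h.sideGraph_not_three_cycle ht e₀ (hadj 1 (by omega)) e₂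
    · have e₀ := hadj 0 (by omega)
      have e₃ := hadj 3 (by omega)
      have c₀ := hchord 0 2 (by omega) (by omega) (by omega)
      rw [h0] at e₀ c₀
      rw [hlast] at e₃
      refine sideGraph_not_four_cycle (fun u v w hu hw huw => ?_) c₀
        (hchord 1 2 (by omega) (by omega) (by omega)) e₀ (hadj 1 (by omega)) (hadj 2 (by omega)) e₃
      exact huw.elim (hcomp _ _ _ hu hw) fun hle => (hcomp _ _ _ hw hu hle).symm
  · have hfour : ∀ i, i + 3 ≤ n →
        ((w.getVert i).1 ≤ (w.getVert (i + 2)).1 → (w.getVert i).1 ≤ (w.getVert (i + 3)).1 ∧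
          (w.getVert (i + 1)).1 ≤ (w.getVert (i + 3)).1) ∧
        ((w.getVert (i + 2)).1 ≤ (w.getVert i).1 → (w.getVert (i + 3)).1 ≤ (w.getVert i).1 ∧
          (w.getVert (i + 3)).1 ≤ (w.getVert (i + 1)).1) := by
      intro i hi
      have a₀ := (hadj i (by omega)).1
      have a₂ := (hadj (i + 2) (by omega)).1
      have c₁ := hchord (i + 1) 2 (by omega) (by omega) (by omega)
      have c₃ := hchord i 3 (by omega) (by omega) (by omega)
      refine ⟨fun hle => ?_, fun hle => ?_⟩
      · have h3 := c₃.resolve_right fun h' => a₂.2 (h'.trans hle)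
        exact ⟨h3, c₁.resolve_right fun h' => a₀.1 (h3.trans h')⟩
      · have h3 := c₃.resolve_left fun h' => a₂.1 (hle.trans h')
        exact ⟨h3, c₁.resolve_left fun h' => a₀.2 (h'.trans h3)⟩
    have hclose : ¬ ((w.getVert 0).1 ≤ (w.getVert (n - 1)).1 ∨
        (w.getVert (n - 1)).1 ≤ (w.getVert 0).1) := by
      have := (hadj (n - 1) (by omega)).1
      rw [Nat.sub_add_cancel (by omega), hlast] at this
      rw [h0]
      exact fun hor => hor.elim this.2 this.1
    refine hclose ?_
    rcases hchord 0 2 (by omega) (by omega) (by omega) with h02 | h02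
    · left
      have hstep : ∀ i, i + 2 ≤ n → (w.getVert i).1 ≤ (w.getVert (i + 2)).1 := fun i hi => by
        induction i with
        | zero => exact h02
        | succ i ih => exact ((hfour i (by omega)).1 (ih (by omega))).2
      have hall : ∀ i, i + 2 ≤ n → (w.getVert 0).1 ≤ (w.getVert (i + 2)).1 := fun i hi => by
        induction i using Nat.twoStepInduction with
        | zero => exact h02
        | one => exact ((hfour 0 (by omega)).1 h02).1
        | more i ih _ => exact (ih (by omega)).trans (hstep _ (by omega))
      have := hall (n - 3) (by omega)
      rwa [show n - 3 + 2 = n - 1 by omega] at this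
    · right
      have hstep : ∀ i, i + 2 ≤ n → (w.getVert (i + 2)).1 ≤ (w.getVert i).1 := fun i hi => by
        induction i with
        | zero => exact h02
        | succ i ih => exact ((hfour i (by omega)).2 (ih (by omega))).2
      have hall : ∀ i, i + 2 ≤ n → (w.getVert (i + 2)).1 ≤ (w.getVert 0).1 := fun i hi => by
        induction i using Nat.twoStepInduction with
        | zero => exact h02
        | one => exact ((hfour 0 (by omega)).2 h02).1
        | more i ih _ => exact (hstep _ (by omega)).trans (ih (by omega))
      have := hall (n - 3) (by omega)
      rwa [show n - 3 + 2 = n - 1 by omega] at this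

end Orientation

section IsConjugate

variable {L : Type u} [Lattice L]

/-- A strict partial order orienting the incomparability graph of a lattice in such a way that
`b` lies between `a` and `c` whenever `R a b` and `R b c`. -/
structure IsConjugate (R : L → L → Prop) : Prop where
  incomp : ∀ {a b}, R a b → a ∥ b
  or_of_incomp : ∀ {a b}, (a ∥ b) → R a b ∨ R b a
  asymm : ∀ {a b}, R a b → ¬ R b a
  trans : ∀ {a b c}, R a b → R b c → R a c
  le_sup : ∀ {a b c}, R a b → R b c → b ≤ a ⊔ c
  congr_left : ∀ {a a' b}, R a b → (a' ∥ b) → (a ≤ a' ∨ a' ≤ a) → R a' b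
  congr_right : ∀ {a b b'}, R a b → (a ∥ b') → (b ≤ b' ∨ b' ≤ b) → R a b'

theorem IsConjugate.swap {R : L → L → Prop} (hR : IsConjugate R) : IsConjugate (flip R) where
  incomp h := (hR.incomp h).symm
  or_of_incomp h := hR.or_of_incomp h.symm
  asymm h := hR.asymm h
  trans h h' := hR.trans h' h
  le_sup h h' := (hR.le_sup h' h).trans_eq (sup_comm _ _)
  congr_left h hi hc := hR.congr_right h hi.symm hc
  congr_right h hi hc := hR.congr_left h hi.symm hc

/-- A choice of directions on all elements which is coherent along the double cover. -/
theorem LocLattice.exists_section [OrderBot L] (h : LocLattice L) {t : L → L → Bool}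
    (ht : ∀ v u w : L, (u ∥ v) → (w ∥ v) → (t v u = t v w ↔ ¬ v ≤ u ⊔ w)) :
    ∃ ε : L → Bool, ∀ u v : L, (u ∥ v) → (ε u ^^ t u v) ≠ (ε v ^^ t v u) := by
  classical
  let S : Setoid L :=
    { r := fun u v => ∃ a b, (sideGraph t).Reachable (u, a) (v, b)
      iseqv :=
        { refl := fun u => ⟨true, true, .rfl⟩
          symm := fun ⟨a, b, hab⟩ => ⟨b, a, hab.symm⟩
          trans := by
            rintro u v w ⟨a, b, hab⟩ ⟨c, d, hcd⟩
            by_cases hbc : b = c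
            · exact ⟨a, d, hab.trans (hbc ▸ hcd)⟩
            · obtain rfl : b = !c := by cases b <;> cases c <;> simp_all
              exact ⟨a, !d, hab.trans (sideGraph_reachable_not hcd)⟩ } }
  have hroot : ∀ v : L, ∃ b, (sideGraph t).Reachable ((Quotient.mk S v).out, true) (v, b) := by
    intro v
    obtain ⟨a, b, hab⟩ : S.r (Quotient.mk S v).out v := Quotient.mk_out (s := S) v
    cases a with
    | true => exact ⟨b, hab⟩
    | false => exact ⟨!b, sideGraph_reachable_not hab⟩
  choose ε hε using hroot
  refine ⟨ε, fun u v huv => ?_⟩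
  have hadj : ∀ a b, (sideGraph t).Adj (u, a) (v, b) → Quotient.mk S u = Quotient.mk S v :=
    fun a b hA => Quotient.sound (s := S) ⟨a, b, hA.reachable⟩
  rcases sideGraph_adj_or (t := t) huv (ε u) (ε v) with hA | hA
  · exact hA.2
  · exfalso
    have hu := hε u
    rw [hadj _ _ hA] at hu
    exact h.not_reachable_not ht (u, ε u) ((hu.symm.trans (hε v)).trans hA.symm.reachable)

theorem LocLattice.exists_isConjugate [OrderBot L] (h : LocLattice L) :
    ∃ R : L → L → Prop, IsConjugate R := by
  obtain ⟨t, ht⟩ := h.exists_side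
  obtain ⟨ε, hε⟩ := h.exists_section ht
  have hside : ∀ {u v w : L}, (u ∥ v) → (w ∥ v) → (u ≤ w ∨ w ≤ u) → t v u = t v w := by
    intro u v w hu hw huw
    refine (ht v u w hu hw).2 fun hle => ?_
    rcases huw with huw | huw
    · exact hw.2 (hle.trans_eq (sup_eq_right.2 huw))
    · exact hu.2 (hle.trans_eq (sup_eq_left.2 huw))
  have hrev : ∀ {u v : L}, (u ∥ v) → ((ε u ^^ t u v) = true ↔ (ε v ^^ t v u) = false) := by
    intro u v huv
    have := hε u v huv
    revert this
    generalize (ε u ^^ t u v) = x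
    generalize (ε v ^^ t v u) = y
    revert x y
    decide
  have hbetween : ∀ {a b c : L}, (a ∥ b) → (b ∥ c) → (ε a ^^ t a b) = true →
      (ε b ^^ t b c) = true → b ≤ a ⊔ c := by
    intro a b c hab hbc h₁ h₂
    by_contra hcon
    rw [hrev hab, (ht b a c hab hbc.symm).2 hcon, h₂] at h₁
    exact absurd h₁ (by decide)
  refine ⟨fun a b => (a ∥ b) ∧ (ε a ^^ t a b) = true, ?_⟩
  constructor
  · exact fun hab => hab.1
  · intro a b hab
    by_cases hb : (ε b ^^ t b a) = true
    · exact Or.inr ⟨hab.symm, hb⟩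
    · exact Or.inl ⟨hab, (hrev hab).2 (Bool.eq_false_iff.2 hb)⟩
  · rintro a b ⟨hab, h₁⟩ ⟨-, h₂⟩
    rw [hrev hab, h₂] at h₁
    exact absurd h₁ (by decide)
  · rintro a b c ⟨hab, h₁⟩ ⟨hbc, h₂⟩
    have hb := hbetween hab hbc h₁ h₂
    have hac := incompRel_of_le_sup hab hbc.symm hb
    refine ⟨hac, ?_⟩
    by_contra hcon
    have h₃ : (ε c ^^ t c a) = true := by
      rw [hrev hac.symm]
      simpa using hcon
    have ha := hbetween hac.symm hab h₃ h₁
    exact h.not_between_of_between hac.symm hbc.symm hab (hb.trans_eq (sup_comm _ _)) ha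
  · rintro a b c ⟨hab, h₁⟩ ⟨hbc, h₂⟩
    exact hbetween hab hbc h₁ h₂
  · rintro a a' b ⟨hab, h₁⟩ ha' hc
    refine ⟨ha', ?_⟩
    rw [hrev ha', ← hside hab ha' hc, ← hrev hab]
    exact h₁
  · rintro a b b' ⟨hab, h₁⟩ hb' hc
    refine ⟨hb', ?_⟩
    rw [← hside hab.symm hb'.symm hc]
    exact h₁

end IsConjugate

section Endpoints

variable {L : Type u} [Lattice L] {R : L → L → Prop}

/-- In every interval representation oriented by `R`, the interval of `c` exceeds that of `b`
to the right. -/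
def Exceeds (R : L → L → Prop) (b c : L) : Prop :=
  ∃ a w, b ≤ a ∧ w ≤ c ∧ R a w

theorem exceeds_of_rel {a b : L} (hab : R a b) : Exceeds R a b :=
  ⟨a, b, le_rfl, le_rfl, hab⟩

theorem IsConjugate.not_exceeds_of_le (hR : IsConjugate R) {a b : L} (hab : a ≤ b) :
    ¬ Exceeds R b a := by
  rintro ⟨c, w, hc, hw, hcw⟩
  exact (hR.incomp hcw).2 (hw.trans (hab.trans hc))

theorem IsConjugate.exceeds_asymm (hR : IsConjugate R) {b c : L} (hbc : Exceeds R b c) :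
    ¬ Exceeds R c b := by
  obtain ⟨a, w, ha, hw, haw⟩ := hbc
  rintro ⟨a', w', ha', hw', haw'⟩
  have hww' : w ∥ w' :=
    ⟨fun hle => (hR.incomp haw).2 (hle.trans (hw'.trans ha)),
      fun hle => (hR.incomp haw').2 (hle.trans (hw.trans ha'))⟩
  exact hR.asymm (hR.congr_left haw hww'.symm (Or.inr (hw'.trans ha)))
    (hR.congr_left haw' hww' (Or.inr (hw.trans ha')))

theorem IsConjugate.exceeds_or_exceeds (hR : IsConjugate R) {a c : L} (hca : Exceeds R c a)
    (b : L) : Exceeds R c b ∨ Exceeds R b a := by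
  obtain ⟨A, w, hA, hw, hAw⟩ := hca
  by_cases hwb : w ≤ b
  · exact Or.inl ⟨A, w, hA, hwb, hAw⟩
  by_cases hbA : b ≤ A
  · exact Or.inr ⟨A, w, hbA, hw, hAw⟩
  by_cases hAb : A ≤ b
  · have hbw : b ∥ w := ⟨fun hle => (hR.incomp hAw).1 (hAb.trans hle), hwb⟩
    exact Or.inr ⟨b, w, le_rfl, hw, hR.congr_left hAw hbw (Or.inl hAb)⟩
  · by_cases hbw : b ≤ w
    · exact Or.inl ⟨A, b, hA, le_rfl, hR.congr_right hAw ⟨hAb, hbA⟩ (Or.inr hbw)⟩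
    · rcases hR.or_of_incomp ⟨hbw, hwb⟩ with hlt | hlt
      · exact Or.inr ⟨b, w, le_rfl, hw, hlt⟩
      · exact Or.inl ⟨A, b, hA, le_rfl, hR.trans hAw hlt⟩

theorem IsConjugate.le_or_le (hR : IsConjugate R) {a b : L} (hab : ¬ Exceeds R a b)
    (hba : ¬ Exceeds R b a) : a ≤ b ∨ b ≤ a := by
  by_contra! hcon
  rcases hR.or_of_incomp (hcon : a ∥ b) with hlt | hlt
  exacts [hab (exceeds_of_rel hlt), hba (exceeds_of_rel hlt)]

variable [OrderBot L]

/-- The right endpoint of `b` is that of a nonempty intersection `p ⊓ q` with `R p q`, so that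
it has to agree with the right endpoint of `p`. -/
def HasFixedEnd (R : L → L → Prop) (b : L) : Prop :=
  ∃ p q, R p q ∧ p ⊓ q ≠ ⊥ ∧ p ⊓ q ≤ b ∧ ¬ Exceeds R p b

/-- The strict order of right endpoints. -/
def EndLT (R : L → L → Prop) (b c : L) : Prop :=
  Exceeds R b c ∨ (b < c ∧ ¬ HasFixedEnd R b)

theorem IsConjugate.hasFixedEnd_of_le (hR : IsConjugate R) {b c : L} (hb : HasFixedEnd R b)
    (hbc : b ≤ c) (hex : ¬ Exceeds R b c) : HasFixedEnd R c := by
  obtain ⟨p, q, hpq, hne, hle, hpb⟩ := hb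
  exact ⟨p, q, hpq, hne, hle.trans hbc, fun hpc =>
    (hR.exceeds_or_exceeds hpc b).elim hpb hex⟩

theorem IsConjugate.not_endLT_of_le (hR : IsConjugate R) {a b : L} (hab : a ≤ b) :
    ¬ EndLT R b a := by
  rintro (hex | ⟨hlt, -⟩)
  exacts [hR.not_exceeds_of_le hab hex, hlt.not_ge hab]

theorem IsConjugate.endLT_asymm (hR : IsConjugate R) {b c : L} (hbc : EndLT R b c) :
    ¬ EndLT R c b := by
  rcases hbc with hbc | ⟨hlt, -⟩
  · rintro (hcb | ⟨hlt, -⟩)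
    exacts [hR.exceeds_asymm hbc hcb, hR.not_exceeds_of_le hlt.le hbc]
  · exact hR.not_endLT_of_le hlt.le

theorem IsConjugate.endLT_or_endLT (hR : IsConjugate R) {a c : L} (hca : EndLT R c a) (b : L) :
    EndLT R c b ∨ EndLT R b a := by
  rcases hca with hca | ⟨hlt, hfix⟩
  · exact (hR.exceeds_or_exceeds hca b).imp Or.inl Or.inl
  by_cases hcb : Exceeds R c b
  · exact Or.inl (Or.inl hcb)
  by_cases hba : Exceeds R b a
  · exact Or.inr (Or.inl hba)
  have hac := hR.not_exceeds_of_le hlt.le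
  have hbc : ¬ Exceeds R b c := fun hex => (hR.exceeds_or_exceeds hex a).elim hba hac
  have hab : ¬ Exceeds R a b := fun hex => (hR.exceeds_or_exceeds hex c).elim hac hcb
  rcases hR.le_or_le hcb hbc with hle | hle
  · rcases hle.eq_or_lt with rfl | hcb'
    · exact Or.inr (Or.inr ⟨hlt, hfix⟩)
    · exact Or.inl (Or.inr ⟨hcb', hfix⟩)
  · exact Or.inr (Or.inr ⟨hle.trans_lt hlt, fun hb => hfix (hR.hasFixedEnd_of_le hb hle hbc)⟩)

theorem IsConjugate.not_exceeds_inf (hR : IsConjugate R) (h : LocLattice L) {p q : L}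
    (hpq : R p q) (hne : p ⊓ q ≠ ⊥) : ¬ Exceeds R (p ⊓ q) p := by
  rintro ⟨a, w, ha, hw, haw⟩
  have hwq : w ∥ q :=
    ⟨fun hle => (hR.incomp haw).2 ((le_inf hw hle).trans ha),
      fun hle => (hR.incomp hpq).2 (hle.trans hw)⟩
  have hRwq := hR.congr_left hpq hwq (Or.inr hw)
  have hbetween := h.inf_sup_eq_of_between (hR.incomp (hR.trans haw hRwq)) (hR.incomp haw)
    (hR.incomp hRwq).symm (hR.le_sup haw hRwq)
  have hcw : p ⊓ q ≤ w :=
    (le_inf (ha.trans le_sup_left) (inf_le_right.trans le_sup_left)).trans_eq hbetween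
  have hsup := h.2.2 a q w (hR.le_sup haw hRwq)
    (ne_bot_of_le_ne_bot hne (le_inf ha hcw)) (ne_bot_of_le_ne_bot hne (le_inf inf_le_right hcw))
  refine (hR.incomp haw).2 (hsup.symm.le.trans (sup_le inf_le_left ?_))
  exact (le_inf (inf_le_right.trans hw) inf_le_left).trans ha

theorem IsConjugate.not_endLT_inf (hR : IsConjugate R) (h : LocLattice L) {a b : L}
    (hab : R a b) (hne : a ⊓ b ≠ ⊥) : ¬ EndLT R (a ⊓ b) a := by
  rintro (hex | ⟨-, hfix⟩)
  · exact hR.not_exceeds_inf h hab hne hex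
  · exact hfix ⟨a, b, hab, hne, le_rfl, hR.not_exceeds_of_le inf_le_left⟩

theorem IsConjugate.exists_of_hasFixedEnd (hR : IsConjugate R) (h : LocLattice L) {a b : L}
    (hlt : b < a) (hex : ¬ Exceeds R b a) (hcomp : ∀ A w, b ≤ A → w ≤ a → A ≤ w ∨ w ≤ A)
    (hfix : HasFixedEnd R b) : ∃ q, R a q ∧ a ⊓ q ≠ ⊥ ∧ a ⊓ q ≤ b := by
  obtain ⟨p, q, hpq, hne, hle, hpb⟩ := hfix
  have hpa : ¬ Exceeds R p a := fun hpa => (hR.exceeds_or_exceeds hpa b).elim hpb hex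
  have hap : ¬ Exceeds R a p := fun hap =>
    (hR.exceeds_or_exceeds hap (p ⊓ q)).elim (hR.not_exceeds_of_le (hle.trans hlt.le))
      (hR.not_exceeds_inf h hpq hne)
  have hpa_comp := hR.le_or_le hpa hap
  have hqa : ¬ q ≤ a := fun hqa => hpa ⟨p, q, le_rfl, hqa, hpq⟩
  have haq : ¬ a ≤ q := fun haq => by
    rcases hpa_comp with hle' | hle'
    · exact (hR.incomp hpq).1 (hle'.trans haq)
    · exact hlt.not_ge ((le_inf hle' haq).trans hle)
  refine ⟨q, hR.congr_left hpq ⟨haq, hqa⟩ hpa_comp,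
    ne_bot_of_le_ne_bot hne (le_inf (hle.trans hlt.le) inf_le_right), ?_⟩
  rcases hcomp b (a ⊓ q) le_rfl inf_le_left with hle' | hle'
  · rcases hcomp q a (hle'.trans inf_le_right) le_rfl with hc | hc
    exacts [absurd hc hqa, absurd hc haq]
  · exact hle'

theorem IsConjugate.endLT_or_endLT_flip_of_not_le (hR : IsConjugate R) (h : LocLattice L) {a b : L}
    (hab : ¬ a ≤ b) : EndLT R b a ∨ EndLT (flip R) b a := by
  by_cases hba : b ≤ a
  swap
  · rcases hR.or_of_incomp (⟨hab, hba⟩ : a ∥ b) with hlt | hlt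
    · exact Or.inr (Or.inl (exceeds_of_rel (R := flip R) hlt))
    · exact Or.inl (Or.inl (exceeds_of_rel hlt))
  have hlt : b < a := lt_of_le_not_ge hba hab
  by_contra! hcon
  obtain ⟨h₁, h₂⟩ := hcon
  simp only [EndLT, not_or, not_and, not_not] at h₁ h₂
  have hcomp : ∀ A w, b ≤ A → w ≤ a → A ≤ w ∨ w ≤ A := by
    intro A w hA hw
    by_contra! hcon
    rcases hR.or_of_incomp (hcon : A ∥ w) with hAw | hAw
    · exact h₁.1 ⟨A, w, hA, hw, hAw⟩
    · exact h₂.1 ⟨A, w, hA, hw, hAw⟩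
  obtain ⟨q, haq, hne, hle⟩ := hR.exists_of_hasFixedEnd h hlt h₁.1 hcomp (h₁.2 hlt)
  obtain ⟨q', haq', hne', hle'⟩ := hR.swap.exists_of_hasFixedEnd h hlt h₂.1 hcomp (h₂.2 hlt)
  have hsup := h.2.2 q' q a (hR.le_sup haq' haq) (by rwa [inf_comm]) (by rwa [inf_comm])
  rw [inf_comm q' a, inf_comm q a] at hsup
  exact hab (hsup.symm.le.trans (sup_le hle' hle))

/-- The interval of `a` ends before that of `b` begins. -/
def Precedes (R : L → L → Prop) (a b : L) : Prop :=
  R a b ∧ a ⊓ b = ⊥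

theorem precedes_flip {a b : L} : Precedes (flip R) a b ↔ Precedes R b a := by
  rw [Precedes, Precedes, inf_comm, flip]

theorem IsConjugate.endLT_of_precedes (hR : IsConjugate R) {a a' b : L} (ha : a ≠ ⊥)
    (hb : b ≠ ⊥) (ha'b : Precedes R a' b) (hab : ¬ Precedes R a b) : EndLT R a' a := by
  left
  by_cases hne : a ⊓ b = ⊥
  · have hinc : a ∥ b :=
      ⟨fun hle => ha (by rwa [inf_eq_left.2 hle] at hne),
        fun hle => hb (by rwa [inf_eq_right.2 hle] at hne)⟩
    rcases hR.or_of_incomp hinc with hlt | hlt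
    · exact absurd ⟨hlt, hne⟩ hab
    · exact exceeds_of_rel (hR.trans ha'b.1 hlt)
  · refine ⟨a', a ⊓ b, le_rfl, inf_le_left, hR.congr_right ha'b.1 ⟨fun hle => ?_, fun hle => ?_⟩
      (Or.inr inf_le_right)⟩
    · exact (hR.incomp ha'b.1).1 (hle.trans inf_le_right)
    · exact hne (le_bot_iff.1 ((le_inf hle inf_le_right).trans ha'b.2.le))

/-- The order of the endpoints of the nonzero elements, `(a, false)` standing for the left and
`(a, true)` for the right endpoint of `a`. -/
def EndpointLE (R : L → L → Prop) : {a : L // a ≠ ⊥} × Bool → {a : L // a ≠ ⊥} × Bool → Prop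
  | (a, false), (b, false) => ¬ EndLT (flip R) a b
  | (a, true), (b, true) => ¬ EndLT R b a
  | (a, true), (b, false) => Precedes R a b
  | (a, false), (b, true) => ¬ Precedes R b a

theorem IsConjugate.endpointLE_total (hR : IsConjugate R) (x y : {a : L // a ≠ ⊥} × Bool) :
    EndpointLE R x y ∨ EndpointLE R y x := by
  obtain ⟨a, _ | _⟩ := x <;> obtain ⟨b, _ | _⟩ := y <;> simp only [EndpointLE]
  · exact or_iff_not_imp_left.2 fun hlt => hR.swap.endLT_asymm (not_not.1 hlt)
  · exact (em _).symm
  · exact em _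
  · exact or_iff_not_imp_left.2 fun hlt => hR.endLT_asymm (not_not.1 hlt)

theorem IsConjugate.endpointLE_trans (hR : IsConjugate R) {x y z : {a : L // a ≠ ⊥} × Bool}
    (hxy : EndpointLE R x y) (hyz : EndpointLE R y z) : EndpointLE R x z := by
  have right : ∀ {a a' b : {a : L // a ≠ ⊥}}, Precedes R a' b → ¬ Precedes R a b →
      EndLT R (a' : L) a := fun {a _ b} => hR.endLT_of_precedes a.2 b.2
  have left : ∀ {a b b' : {a : L // a ≠ ⊥}}, Precedes R a b' → ¬ Precedes R a b →
      EndLT (flip R) (b' : L) b := fun {a b _} h₁ h₂ =>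
    hR.swap.endLT_of_precedes b.2 a.2 (precedes_flip.2 h₁) (mt precedes_flip.1 h₂)
  obtain ⟨a, _ | _⟩ := x <;> obtain ⟨b, _ | _⟩ := y <;> obtain ⟨c, _ | _⟩ := z <;>
    simp only [EndpointLE] at hxy hyz ⊢
  · exact fun hlt => (hR.swap.endLT_or_endLT hlt b).elim hxy hyz
  · exact fun hp => hxy (left hp hyz)
  · exact hR.swap.endLT_asymm (left hyz hxy)
  · exact fun hp => hyz (right hp hxy)
  · exact by_contra fun hp => hyz (left hxy hp)
  · exact hR.endLT_asymm (right hxy hyz)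
  · exact by_contra fun hp => hxy (right hyz hp)
  · exact fun hlt => (hR.endLT_or_endLT hlt b).elim hyz hxy

end Endpoints

/-- A lattice is represented by half-open intervals as soon as suitable endpoints can be chosen
in a total preorder. -/
theorem exists_representation_of_endpoints {L : Type u} [Lattice L] [OrderBot L] {E : Type u}
    {le : E → E → Prop} (total : ∀ x y, le x y ∨ le y x)
    (trans : ∀ {x y z}, le x y → le y z → le x z) (l r : {a : L // a ≠ ⊥} → E)
    (hlr : ∀ a, ¬ le (r a) (l a))
    (hle : ∀ a b : {a : L // a ≠ ⊥}, (a : L) ≤ b ↔ le (l b) (l a) ∧ le (r a) (r b))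
    (hdisj : ∀ a b : {a : L // a ≠ ⊥}, (a : L) ⊓ b = ⊥ → le (r a) (l b) ∨ le (r b) (l a))
    (hinf : ∀ a b c : {a : L // a ≠ ⊥}, (a : L) ⊓ b = c →
      (le (l c) (l a) ∨ le (l c) (l b)) ∧ (le (r a) (r c) ∨ le (r b) (r c))) :
    ∃ (X : Type u) (le : X → X → Prop) (f : L → Set X),
      IsLinearOrder X le ∧
      (∀ a b : L, a ≤ b ↔ f a ⊆ f b) ∧
      (∀ a : L, RelConvex le (f a)) ∧
      f ⊥ = ∅ ∧
      (∀ a b : L, f (a ⊓ b) = f a ∩ f b) := by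
  let P : Preorder E :=
    { le := le
      le_refl := fun x => (total x x).elim id id
      le_trans := fun _ _ _ => trans }
  let f : L → Set (Antisymmetrization E (· ≤ ·)) := fun a =>
    {x | ∃ ha : a ≠ ⊥, toAntisymmetrization (· ≤ ·) (l ⟨a, ha⟩) ≤ x ∧
      ¬ toAntisymmetrization (· ≤ ·) (r ⟨a, ha⟩) ≤ x}
  have hmem : ∀ a (ha : a ≠ ⊥) (x : E), toAntisymmetrization (· ≤ ·) x ∈ f a ↔
      le (l ⟨a, ha⟩) x ∧ ¬ le (r ⟨a, ha⟩) x :=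
    fun a ha x => ⟨fun ⟨_, h₁, h₂⟩ => ⟨h₁, h₂⟩, fun ⟨h₁, h₂⟩ => ⟨ha, h₁, h₂⟩⟩
  have hmono : ∀ a b : L, a ≤ b → f a ⊆ f b := by
    rintro a b hab x ⟨ha, h₁, h₂⟩
    obtain ⟨h₃, h₄⟩ := (hle ⟨a, ha⟩ ⟨b, ne_bot_of_le_ne_bot ha hab⟩).1 hab
    exact ⟨ne_bot_of_le_ne_bot ha hab, le_trans (α := Antisymmetrization E (· ≤ ·)) h₃ h₁,
      fun h₅ => h₂ (le_trans (α := Antisymmetrization E (· ≤ ·)) h₄ h₅)⟩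
  refine ⟨Antisymmetrization E (· ≤ ·), (· ≤ ·), f, ?_, fun a b => ⟨hmono a b, fun hab => ?_⟩,
    ?_, ?_, fun a b => ?_⟩
  · exact { total := fun x y => by
              induction x using Antisymmetrization.ind
              induction y using Antisymmetrization.ind
              exact total _ _ }
  · by_cases ha : a = ⊥
    · exact ha ▸ bot_le
    have hla := hab ((hmem a ha (l ⟨a, ha⟩)).2 ⟨le_refl (α := E) _, hlr _⟩)
    have hb : b ≠ ⊥ := hla.choose
    obtain ⟨h₁, h₂⟩ := (hmem b hb _).1 hla
    refine (hle ⟨a, ha⟩ ⟨b, hb⟩).2 ⟨h₁, by_contra fun hcon => ?_⟩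
    have hrb := hab ((hmem a ha (r ⟨b, hb⟩)).2 ⟨(total _ _).resolve_right h₂, hcon⟩)
    exact ((hmem b hb _).1 hrb).2 (le_refl (α := E) _)
  · rintro a x y z ⟨ha, h₁, -⟩ ⟨_, _, h₂⟩ hxy hyz
    exact ⟨ha, h₁.trans hxy, fun h₃ => h₂ (h₃.trans hyz)⟩
  · exact Set.eq_empty_of_forall_notMem fun x hx => hx.choose rfl
  · refine (Set.subset_inter (hmono _ _ inf_le_left) (hmono _ _ inf_le_right)).antisymm ?_
    intro x
    induction x using Antisymmetrization.ind with | _ x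
    rintro ⟨hxa, hxb⟩
    have ha : a ≠ ⊥ := hxa.choose
    have hb : b ≠ ⊥ := hxb.choose
    obtain ⟨h₁, h₂⟩ := (hmem a ha x).1 hxa
    obtain ⟨h₃, h₄⟩ := (hmem b hb x).1 hxb
    by_cases hab : a ⊓ b = ⊥
    · rcases hdisj ⟨a, ha⟩ ⟨b, hb⟩ hab with hd | hd
      exacts [absurd (trans hd h₃) h₂, absurd (trans hd h₁) h₄]
    · obtain ⟨h₅, h₆⟩ := hinf ⟨a, ha⟩ ⟨b, hb⟩ ⟨a ⊓ b, hab⟩ rfl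
      refine (hmem _ hab x).2 ⟨h₅.elim (fun h' => trans h' h₁) fun h' => trans h' h₃, fun hc => ?_⟩
      exact h₆.elim (fun h' => h₂ (trans h' hc)) fun h' => h₄ (trans h' hc)

theorem every_loc_lattice_representable {L : Type u} [Lattice L] [OrderBot L]
    (h : LocLattice L) :
    ∃ (X : Type u) (le : X → X → Prop) (f : L → Set X),
      IsLinearOrder X le ∧
      (∀ a b : L, a ≤ b ↔ f a ⊆ f b) ∧
      (∀ a : L, RelConvex le (f a)) ∧
      f ⊥ = ∅ ∧
      (∀ a b : L, f (a ⊓ b) = f a ∩ f b) := by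
  obtain ⟨R, hR⟩ := h.exists_isConjugate
  refine exists_representation_of_endpoints hR.endpointLE_total hR.endpointLE_trans
    (fun a => (a, false)) (fun a => (a, true)) (fun a hp => a.2 ?_) (fun a b => ?_)
    (fun a b hab => ?_) fun a b c hc => ?_
  · exact inf_idem (a : L) ▸ hp.2
  · refine ⟨fun hab => ⟨hR.swap.not_endLT_of_le hab, hR.not_endLT_of_le hab⟩, fun hab => ?_⟩
    by_contra hcon
    exact (hR.endLT_or_endLT_flip_of_not_le h hcon).elim hab.2 hab.1
  · have hinc : (a : L) ∥ b :=
      ⟨fun hle => a.2 (by rwa [inf_eq_left.2 hle] at hab),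
        fun hle => b.2 (by rwa [inf_eq_right.2 hle] at hab)⟩
    exact (hR.or_of_incomp hinc).imp (fun hlt => ⟨hlt, hab⟩)
      fun hlt => ⟨hlt, inf_comm (b : L) a ▸ hab⟩
  · have hne : (a : L) ⊓ b ≠ ⊥ := hc ▸ c.2
    have hne' : (b : L) ⊓ a ≠ ⊥ := inf_comm (a : L) b ▸ hne
    have hc' : (b : L) ⊓ a = c := inf_comm (a : L) b ▸ hc
    simp only [EndpointLE]
    by_cases hab : (a : L) ≤ b
    · rw [inf_eq_left.2 hab] at hc
      rw [← hc]
      exact ⟨Or.inl (hR.swap.not_endLT_of_le le_rfl), Or.inl (hR.not_endLT_of_le le_rfl)⟩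
    by_cases hba : (b : L) ≤ a
    · rw [inf_eq_right.2 hba] at hc
      rw [← hc]
      exact ⟨Or.inr (hR.swap.not_endLT_of_le le_rfl), Or.inr (hR.not_endLT_of_le le_rfl)⟩
    rcases hR.or_of_incomp (⟨hab, hba⟩ : (a : L) ∥ b) with hlt | hlt
    · exact ⟨Or.inr (hc' ▸ hR.swap.not_endLT_inf h hlt hne'),
        Or.inl (hc ▸ hR.not_endLT_inf h hlt hne)⟩
    · exact ⟨Or.inl (hc ▸ hR.swap.not_endLT_inf h hlt hne),
        Or.inr (hc' ▸ hR.not_endLT_inf h hlt hne')⟩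
end

section
/- Let 𝓜 be a loc-lattice of subsets of a set X which separates the points of X. Then there exists a linear ordering ≤ of X such that every M ∈ 𝓜 is a convex subset of (X, ≤). -/
universe u

/-- `(xyz)_𝓜` : every member of `𝓜` containing `x` and `z` also contains `y`. -/
def MBtw {X : Type u} (𝓜 : Set (Set X)) (x y z : X) : Prop :=
  ∀ M ∈ 𝓜, x ∈ M → z ∈ M → y ∈ M

/-- A loc-lattice of subsets of `X`: `𝓜` is a lattice under inclusion whose joins are
given by `sup` and whose meets are intersections, satisfying conditions (1)-(4) of
Definition 2.1 of the paper. -/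
structure SetLocLattice {X : Type u} (𝓜 : Set (Set X)) (sup : Set X → Set X → Set X) :
    Prop where
  sup_mem : ∀ A ∈ 𝓜, ∀ B ∈ 𝓜, sup A B ∈ 𝓜
  subset_sup_left : ∀ A ∈ 𝓜, ∀ B ∈ 𝓜, A ⊆ sup A B
  subset_sup_right : ∀ A ∈ 𝓜, ∀ B ∈ 𝓜, B ⊆ sup A B
  sup_least : ∀ A ∈ 𝓜, ∀ B ∈ 𝓜, ∀ C ∈ 𝓜, A ⊆ C → B ⊆ C → sup A B ⊆ C
  inter_mem : ∀ A ∈ 𝓜, ∀ B ∈ 𝓜, A ∩ B ∈ 𝓜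
  sup_eq_union : ∀ A ∈ 𝓜, ∀ B ∈ 𝓜, (A ∩ B).Nonempty → sup A B = A ∪ B
  trichotomy : ∀ A ∈ 𝓜, ∀ B ∈ 𝓜, ∀ C ∈ 𝓜,
    A ⊆ sup B C ∨ B ⊆ sup A C ∨ C ⊆ sup A B
  incomp : ∀ A ∈ 𝓜, ∀ B ∈ 𝓜, ∀ C ∈ 𝓜,
    (¬ A ⊆ B ∧ ¬ B ⊆ A) → (¬ A ⊆ C ∧ ¬ C ⊆ A) → (¬ B ⊆ C ∧ ¬ C ⊆ B) →
    B ⊆ sup A C → B = sup A B ∩ sup C B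

/-- `𝓜` separates the points of `X`. -/
def SeparatesPoints {X : Type u} (𝓜 : Set (Set X)) : Prop :=
  ∀ x y : X, x ≠ y → ∃ M ∈ 𝓜, (x ∈ M ∧ y ∉ M) ∨ (x ∉ M ∧ y ∈ M)

/-- `𝓜` well separates `X`. -/
def WellSeparates {X : Type u} (𝓜 : Set (Set X)) : Prop :=
  SeparatesPoints 𝓜 ∧ ∀ M ∈ 𝓜, ∀ x : X, x ∉ M → ∃ N ∈ 𝓜, x ∈ N ∧ ¬ N ⊆ M

/-- Two points are completely separated by `𝓜`. -/
def CompSeparated {X : Type u} (𝓜 : Set (Set X)) (x y : X) : Prop :=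
  ∃ A ∈ 𝓜, ∃ B ∈ 𝓜, x ∈ A ∧ y ∉ A ∧ y ∈ B ∧ x ∉ B

/-- `𝓜` completely separates `X`. -/
def CompletelySeparates {X : Type u} (𝓜 : Set (Set X)) : Prop :=
  ∀ x y : X, x ≠ y → CompSeparated 𝓜 x y

/-- Axioms for a relation `S y a c`, read as "`a` and `c` lie on the same side of `y`". -/
structure SideRel {X : Type u} (S : X → X → X → Prop) : Prop where
  irrefl : ∀ y, ¬ S y y y
  symm : ∀ {y a c}, S y a c → S y c a
  left : ∀ {y a c}, S y a c → S y a a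
  trans : ∀ {y a b c}, S y a b → S y b c → S y a c
  two_sides : ∀ {y a b c}, S y a a → S y b b → S y c c → S y a b ∨ S y b c ∨ S y a c
  separated : ∀ {x y}, x ≠ y → S y x x ∨ S x y y
  down : ∀ {x y z c}, ¬ S x y y → S z y c → S z x c
  split : ∀ {y a c} (x), S y a c → S y x a ∨ S x a c
  not_all : ∀ {x y z}, S x y z → S y x z → S z x y → False
  one_middle : ∀ {x y z}, S y x x → S x y y → S z y y → S y z z → S z x x → S x z z →
    ¬ S y x z → S x y z

/-- A walk in the complement of a strict partial order cannot be a chordless cycle of length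
at least five. -/
theorem not_chordless_of_lt {X : Type u} {I lt : X → X → Prop}
    (lt_trans : ∀ {x y z}, lt x y → lt y z → lt x z)
    (I_symm : ∀ {x y}, I x y → I y x)
    (not_lt : ∀ {x y}, I x y → ¬ lt x y)
    {n : ℕ} (hn : 4 ≤ n) {v : ℕ → X} (hv : ∀ i < n, I (v i) (v (i + 1)))
    (h0n : I (v 0) (v n))
    (hc : ∀ i j, i + 2 ≤ j → j ≤ n → j < n + i → lt (v i) (v j) ∨ lt (v j) (v i))
    (h02 : lt (v 0) (v 2)) : False := by
  have key : ∀ j, 2 ≤ j → j < n → lt (v 0) (v j) := by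
    intro j hj
    induction j, hj using Nat.le_induction with
    | base => exact fun _ => h02
    | succ j hj ih =>
      intro hjn
      rcases hc 0 (j + 1) (by omega) (by omega) (by omega) with h | h
      · exact h
      · exact (not_lt (I_symm (hv j (by omega))) (lt_trans h (ih (by omega)))).elim
  have hn2 : lt (v n) (v 2) := by
    rcases hc 2 n (by omega) le_rfl (by omega) with h | h
    · exact (not_lt h0n (lt_trans h02 h)).elim
    · exact h
  have hn1 : lt (v n) (v 1) := by
    rcases hc 1 n (by omega) le_rfl (by omega) with h | h
    · exact (not_lt (hv 1 (by omega)) (lt_trans h hn2)).elim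
    · exact h
  have hlast : I (v (n - 1)) (v n) := by
    have := hv (n - 1) (by omega)
    rwa [show n - 1 + 1 = n by omega] at this
  rcases hc 1 (n - 1) (by omega) (by omega) (by omega) with h | h
  · exact not_lt (I_symm hlast) (lt_trans hn1 h)
  · exact not_lt (hv 0 (by omega)) (lt_trans (key (n - 1) (by omega) (by omega)) h)

/-- In a double cover of an incomparability graph over which all triangles and chordless
squares lift to cycles, the endpoints of a walk are adjacent as soon as they lie over
incomparable points. -/
theorem adj_of_walk {X Y : Type u} {π : Y → X} {I lt : X → X → Prop} {Adj : Y → Y → Prop}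
    (lt_trans : ∀ {x y z}, lt x y → lt y z → lt x z)
    (I_symm : ∀ {x y}, I x y → I y x)
    (I_irrefl : ∀ x, ¬ I x x)
    (not_lt : ∀ {x y}, I x y → ¬ lt x y)
    (tri : ∀ x y, x = y ∨ I x y ∨ lt x y ∨ lt y x)
    (adj_I : ∀ {p q}, Adj p q → I (π p) (π q))
    (same : ∀ {p q r}, Adj p q → Adj q r → π p = π r → p = r)
    (triangle : ∀ {p q r}, Adj p q → Adj q r → I (π p) (π r) → Adj p r)
    (square : ∀ {p q r s}, Adj p q → Adj q r → Adj r s → I (π p) (π s) →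
      (lt (π p) (π r) ∨ lt (π r) (π p)) → (lt (π q) (π s) ∨ lt (π s) (π q)) → Adj p s)
    (n : ℕ) : ∀ p : ℕ → Y, (∀ i < n, Adj (p i) (p (i + 1))) →
      I (π (p 0)) (π (p n)) → Adj (p 0) (p n) := by
  induction n using Nat.strong_induction_on with
  | _ n ih =>
  intro p hp h0n
  have seg : ∀ i j, i < j → j ≤ n → j < n + i → I (π (p i)) (π (p j)) → Adj (p i) (p j) := by
    intro i j hij hjn hlt hI
    have := ih (j - i) (by omega) (fun k => p (i + k)) (fun k hk => hp (i + k) (by omega))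
    simp only [Nat.add_zero, show i + (j - i) = j by omega] at this
    exact this hI
  by_contra hcon
  have comp : ∀ i j, i + 2 ≤ j → j ≤ n → j < n + i →
      lt (π (p i)) (π (p j)) ∨ lt (π (p j)) (π (p i)) := by
    intro i j hij hjn hlt
    rcases tri (π (p i)) (π (p j)) with h | h | h
    · exfalso
      have hj : Adj (p (j - 1)) (p j) := by
        have := hp (j - 1) (by omega)
        rwa [show j - 1 + 1 = j by omega] at this
      have hi : Adj (p i) (p (j - 1)) := by
        refine seg _ _ (by omega) (by omega) (by omega) ?_
        rw [h]
        exact I_symm (adj_I hj)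
      have heq : p i = p j := same hi hj h
      have := ih (n - (j - i)) (by omega) (fun k => if k ≤ i then p k else p (k + (j - i))) (by
        intro k hk
        rcases lt_trichotomy k i with h1 | h1 | h1
        · rw [if_pos h1.le, if_pos (by omega)]
          exact hp k (by omega)
        · subst h1
          rw [if_pos le_rfl, if_neg (by omega), heq]
          have := hp j (by omega)
          rwa [show k + 1 + (j - k) = j + 1 by omega]
        · rw [if_neg (by omega), if_neg (by omega)]
          have := hp (k + (j - i)) (by omega)
          rwa [show k + 1 + (j - i) = k + (j - i) + 1 by omega])
      have hend : (if n - (j - i) ≤ i then p (n - (j - i)) else p (n - (j - i) + (j - i)))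
          = p n := by
        split_ifs with h1
        · rw [show n - (j - i) = i by omega, heq, show j = n by omega]
        · rw [show n - (j - i) + (j - i) = n by omega]
      simp only [Nat.zero_le, if_true, hend] at this
      exact hcon (this h0n)
    · exfalso
      have hadj := seg i j (by omega) hjn hlt h
      have := ih (n - (j - i) + 1) (by omega)
        (fun k => if k ≤ i then p k else p (k + (j - i) - 1)) (by
        intro k hk
        rcases lt_trichotomy k i with h1 | h1 | h1
        · rw [if_pos h1.le, if_pos (by omega)]
          exact hp k (by omega)
        · subst h1
          rw [if_pos le_rfl, if_neg (by omega)]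
          rwa [show k + 1 + (j - k) - 1 = j by omega]
        · rw [if_neg (by omega), if_neg (by omega)]
          have := hp (k + (j - i) - 1) (by omega)
          rwa [show k + 1 + (j - i) - 1 = k + (j - i) - 1 + 1 by omega])
      have hend : (if n - (j - i) + 1 ≤ i then p (n - (j - i) + 1)
          else p (n - (j - i) + 1 + (j - i) - 1)) = p n := by
        rw [if_neg (by omega), show n - (j - i) + 1 + (j - i) - 1 = n by omega]
      simp only [Nat.zero_le, if_true, hend] at this
      exact hcon (this h0n)
    · exact h
  rcases Nat.lt_or_ge n 4 with hn | hn
  · interval_cases n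
    · exact I_irrefl _ h0n
    · exact hcon (hp 0 (by omega))
    · exact hcon (triangle (hp 0 (by omega)) (hp 1 (by omega)) h0n)
    · exact hcon (square (hp 0 (by omega)) (hp 1 (by omega)) (hp 2 (by omega)) h0n
        (comp 0 2 (by omega) (by omega) (by omega)) (comp 1 3 (by omega) (by omega) (by omega)))
  · rcases comp 0 2 (by omega) (by omega) (by omega) with h | h
    · exact not_chordless_of_lt (v := fun i => π (p i)) (lt := lt) lt_trans I_symm not_lt hn
        (fun i hi => adj_I (hp i hi)) h0n comp h
    · exact not_chordless_of_lt (v := fun i => π (p i)) (lt := fun x y => lt y x)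
        (fun h1 h2 => lt_trans h2 h1) I_symm (fun h1 => not_lt (I_symm h1)) hn
        (fun i hi => adj_I (hp i hi)) h0n (fun i j h1 h2 h3 => (comp i j h1 h2 h3).symm) h

theorem exists_walk_of_reflTransGen {Y : Type u} {R : Y → Y → Prop} {a b : Y}
    (hab : Relation.ReflTransGen R a b) :
    ∃ (n : ℕ) (p : ℕ → Y), p 0 = a ∧ p n = b ∧ ∀ i < n, R (p i) (p (i + 1)) := by
  induction hab using Relation.ReflTransGen.head_induction_on with
  | refl => exact ⟨0, fun _ => b, rfl, rfl, by simp⟩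
  | @head a c hac _ ih =>
    obtain ⟨n, p, h0, hn, hp⟩ := ih
    refine ⟨n + 1, fun k => Nat.casesOn k a p, rfl, hn, ?_⟩
    rintro (_ | i) hi
    · simpa [h0] using hac
    · exact hp i (by omega)

theorem reflTransGen_symm {Y : Type u} {R : Y → Y → Prop} (hR : ∀ {a b}, R a b → R b a)
    {a b : Y} (hab : Relation.ReflTransGen R a b) : Relation.ReflTransGen R b a := by
  induction hab with
  | refl => exact .refl
  | tail _ hbc ih => exact .head (hR hbc) ih

namespace SideRel

variable {X : Type u} {S : X → X → X → Prop}

/-- Each of the two points can be found on a side of the other. -/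
def Inc (S : X → X → X → Prop) (x y : X) : Prop := S y x x ∧ S x y y

/-- `x` lies on a side of `y`, but not conversely. -/
def Below (S : X → X → X → Prop) (x y : X) : Prop := S y x x ∧ ¬ S x y y

theorem Inc.symm {x y : X} (h : Inc S x y) : Inc S y x := ⟨h.2, h.1⟩

theorem right (hS : SideRel S) {y a c : X} (h : S y a c) : S y c c := hS.left (hS.symm h)

theorem below_trans (hS : SideRel S) {x y z : X} (hxy : Below S x y) (hyz : Below S y z) :
    Below S x z :=
  ⟨hS.left (hS.down hxy.2 hyz.1), fun h => hxy.2 (hS.left (hS.down hyz.2 h))⟩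

theorem eq_or_inc_or_below (hS : SideRel S) (x y : X) :
    x = y ∨ Inc S x y ∨ Below S x y ∨ Below S y x := by
  have := @separated _ _ hS x y
  unfold Inc Below
  tauto

/-- The two sides of a point are the two fibres of a predicate. -/
theorem exists_side (hS : SideRel S) (y : X) :
    ∃ P : X → Prop, ∀ a c, S y a a → S y c c → (S y a c ↔ (P a ↔ P c)) := by
  by_cases h : ∃ r, S y r r
  · obtain ⟨r, hr⟩ := h
    refine ⟨fun a => S y a r, fun a c ha hc => ⟨fun hac => ?_, fun hac => ?_⟩⟩
    · exact ⟨fun h => hS.trans (hS.symm hac) h, fun h => hS.trans hac h⟩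
    · by_cases har : S y a r
      · exact hS.trans har (hS.symm (hac.1 har))
      · have hcr : ¬ S y c r := fun h => har (hac.2 h)
        rcases hS.two_sides ha hc hr with h | h | h
        · exact h
        · exact (hcr h).elim
        · exact (har h).elim
  · exact ⟨fun _ => True, fun a c ha _ => (h ⟨a, ha⟩).elim⟩

/-- Adjacency of points with chosen left sides: the points are incomparable, and the first is
to the left of the second exactly when the second is not to the left of the first. -/
def Adj (S : X → X → X → Prop) (P : X → X → Prop) (p q : X × Prop) : Prop :=
  Inc S p.1 q.1 ∧ ((P q.1 p.1 ↔ q.2) ↔ ¬ (P p.1 q.1 ↔ p.2))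

theorem Adj.symm {P : X → X → Prop} {p q : X × Prop} (h : Adj S P p q) : Adj S P q p :=
  ⟨h.1.symm, by have := h.2; tauto⟩

theorem adj_triangle (hS : SideRel S) {P : X → X → Prop}
    (hP : ∀ y a c, S y a a → S y c c → (S y a c ↔ (P y a ↔ P y c)))
    {p q r : X × Prop} (hpq : Adj S P p q) (hqr : Adj S P q r) (hI : Inc S p.1 r.1) :
    Adj S P p r := by
  obtain ⟨x, s⟩ := p
  obtain ⟨y, t⟩ := q
  obtain ⟨z, u⟩ := r
  obtain ⟨⟨h1, h2⟩, hb1⟩ := hpq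
  obtain ⟨⟨h3, h4⟩, hb2⟩ := hqr
  obtain ⟨h5, h6⟩ := hI
  dsimp only at *
  refine ⟨⟨h5, h6⟩, ?_⟩
  dsimp only
  have e1 := hS.not_all (x := x) (y := y) (z := z)
  have e2 : ¬ S y x z → S x y z := hS.one_middle h1 h2 h3 h4 h5 h6
  have e3 : ¬ S y z x → S z y x := hS.one_middle h4 h3 h2 h1 h6 h5
  have e5 : ¬ S x z y → S z x y := hS.one_middle h6 h5 h1 h2 h4 h3
  rw [hP _ _ _ h2 h6, hP _ _ _ h1 h4, hP _ _ _ h5 h3] at e1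
  rw [hP _ _ _ h2 h6, hP _ _ _ h1 h4] at e2
  rw [hP _ _ _ h4 h1, hP _ _ _ h3 h5] at e3
  rw [hP _ _ _ h6 h2, hP _ _ _ h5 h3] at e5
  clear hP
  grind

theorem same_side_of_below (hS : SideRel S) {x y z : X} (hxy : Below S x y ∨ Below S y x)
    (hx : S z x x) (hy : S z y y) : S z x y := by
  rcases hxy with h | h
  · exact hS.down h.2 hy
  · exact hS.symm (hS.down h.2 hx)

theorem adj_square (hS : SideRel S) {P : X → X → Prop}
    (hP : ∀ y a c, S y a a → S y c c → (S y a c ↔ (P y a ↔ P y c)))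
    {p q r s : X × Prop} (hpq : Adj S P p q) (hqr : Adj S P q r) (hrs : Adj S P r s)
    (hI : Inc S p.1 s.1) (hpr : Below S p.1 r.1 ∨ Below S r.1 p.1)
    (hqs : Below S q.1 s.1 ∨ Below S s.1 q.1) : Adj S P p s := by
  refine ⟨hI, ?_⟩
  have e1 := (hP _ _ _ hpq.1.2 hI.2).1 (hS.same_side_of_below hqs hpq.1.2 hI.2)
  have e2 := (hP _ _ _ hqr.1.1 hrs.1.2).1 (hS.same_side_of_below hqs hqr.1.1 hrs.1.2)
  have e3 := (hP _ _ _ hpq.1.1 hqr.1.2).1 (hS.same_side_of_below hpr hpq.1.1 hqr.1.2)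
  have e4 := (hP _ _ _ hI.1 hrs.1.1).1 (hS.same_side_of_below hpr hI.1 hrs.1.1)
  have b1 := hpq.2
  have b2 := hqr.2
  have b3 := hrs.2
  clear hP hpr hqs hI hrs hqr hpq
  grind

theorem adj_of_reflTransGen (hS : SideRel S) {P : X → X → Prop}
    (hP : ∀ y a c, S y a a → S y c c → (S y a c ↔ (P y a ↔ P y c)))
    {p q : X × Prop} (h : Relation.ReflTransGen (Adj S P) p q) (hI : Inc S p.1 q.1) :
    Adj S P p q := by
  obtain ⟨n, w, rfl, rfl, hw⟩ := exists_walk_of_reflTransGen h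
  refine adj_of_walk (π := Prod.fst) (I := Inc S) (lt := Below S) hS.below_trans
    Inc.symm (fun x h => hS.irrefl x h.1) (fun h h' => h'.2 h.2) hS.eq_or_inc_or_below
    (fun h => h.1) ?_ (hS.adj_triangle hP) (hS.adj_square hP) n w hw hI
  rintro ⟨x, s⟩ ⟨y, t⟩ ⟨z, u⟩ h1 h2 h3
  have b1 := h1.2
  have b2 := h2.2
  dsimp only at h3 b1 b2
  subst h3
  have : s = u := propext (by clear h1 h2; tauto)
  rw [this]

/-- There is a choice of left sides that is consistent on all incomparable pairs. -/
theorem exists_adj_label (hS : SideRel S) {P : X → X → Prop}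
    (hP : ∀ y a c, S y a a → S y c c → (S y a c ↔ (P y a ↔ P y c))) :
    ∃ f : X → Prop, ∀ x y, Inc S x y → Adj S P (x, f x) (y, f y) := by
  let T : Setoid X := ⟨Relation.ReflTransGen (Inc S),
    fun _ => .refl, fun h => reflTransGen_symm Inc.symm h,
    fun h h' => h.trans h'⟩
  let r : X → X := fun x => (Quotient.mk T x).out
  have hr : ∀ x, Relation.ReflTransGen (Inc S) (r x) x := fun x => Quotient.mk_out (s := T) x
  have hlift : ∀ a x, Relation.ReflTransGen (Inc S) a x →
      ∃ s, Relation.ReflTransGen (Adj S P) (a, True) (x, s) := by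
    intro a x h
    induction h with
    | refl => exact ⟨True, .refl⟩
    | @tail b c _ hbc ih =>
      obtain ⟨s, hs⟩ := ih
      refine ⟨(P c b ↔ ¬ (P b c ↔ s)), hs.tail ⟨hbc, ?_⟩⟩
      dsimp only
      tauto
  choose f hf using fun x => hlift (r x) x (hr x)
  refine ⟨f, fun x y hxy => ?_⟩
  have hxy' : r x = r y := by
    have : Quotient.mk T x = Quotient.mk T y := Quotient.sound (s := T) (.single hxy)
    simp only [r, this]
  have h1 : Relation.ReflTransGen (Adj S P) (x, f x) (r x, True) :=
    reflTransGen_symm Adj.symm (hf x)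
  have h2 := hf y
  rw [← hxy'] at h2
  exact hS.adj_of_reflTransGen hP (h1.trans h2) hxy

/-- There is a choice of left sides `L` that is consistent on incomparable pairs and on pairs of
points lying on opposite sides of a third one. -/
theorem exists_left (hS : SideRel S) :
    ∃ L : X → X → Prop, (∀ y a c, S y a a → S y c c → (S y a c ↔ (L y a ↔ L y c))) ∧
      (∀ x y, Inc S x y → (L y x ↔ ¬ L x y)) ∧
      ∀ x y z, Below S x y → Below S z y → Inc S x z → ¬ S y x z → L y x → L z x := by
  choose P hP using hS.exists_side
  obtain ⟨f, hf⟩ := hS.exists_adj_label hP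
  have hL : ∀ (g : X → Prop) y a c, S y a a → S y c c →
      (S y a c ↔ ((P y a ↔ g y) ↔ (P y c ↔ g y))) := by
    intro g y a c ha hc
    rw [hP y a c ha hc]
    tauto
  have hinc : ∀ {x y z}, S y x x → S y z z → ¬ S y x z → Inc S x z := by
    intro x y z hx hz hxz
    have h1 := hS.split x hz
    have h2 := hS.split z hx
    exact ⟨h2.resolve_left fun h => hxz (hS.symm h), h1.resolve_left hxz⟩
  have hg : ∀ y, ∃ s : Prop, ((∃ w, Inc S y w) → s = f y) ∧
      ∀ x z, Below S x y → Below S z y → ¬ S y x z → (P y x ↔ s) → (P z x ↔ f z) := by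
    intro y
    by_cases hw : ∃ w, Inc S y w
    · refine ⟨f y, fun _ => rfl, ?_⟩
      obtain ⟨w, hyw⟩ := hw
      have key : ∀ x z, Below S x y → Below S z y → ¬ S y x z → ¬ S y w z →
          ((P y x ↔ f y) ↔ (P z x ↔ f z)) := by
        intro x z hx hz hxz hwz
        have hxz' : Inc S x z := hinc hx.1 hz.1 hxz
        have hwz' : Inc S w z := hinc hyw.2 hz.1 hwz
        have hwx : S y w x := by
          rcases hS.two_sides hyw.2 hx.1 hz.1 with h | h | h
          · exact h
          · exact (hxz h).elim
          · exact (hwz h).elim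
        have hzwx : S z w x :=
          (hS.split z hwx).resolve_left fun h => hwz (hS.symm h)
        have hwyz : S w y z := hS.symm (hS.down hz.2 hyw.1)
        have a1 := (hL f _ _ _ hyw.2 hx.1).1 hwx
        have a2 := (hL f _ _ _ hwz'.1 hxz'.1).1 hzwx
        have a3 := (hL f _ _ _ hyw.1 hwz'.2).1 hwyz
        have b1 := (hf _ _ hyw).2
        have b2 := (hf _ _ hwz').2
        dsimp only at b1 b2
        rw [← a1, ← a2, b2, ← a3, b1, not_not]
      intro x z hx hz hxz hpx
      by_cases hwz : S y w z
      · have hwx : ¬ S y w x := fun h => hxz (hS.trans (hS.symm h) hwz)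
        have hzx : ¬ S y z x := fun h => hxz (hS.symm h)
        have k := key z x hz hx hzx hwx
        have b := (hf _ _ (hinc hx.1 hz.1 hxz)).2
        have d := hL f y x z hx.1 hz.1
        dsimp only at b
        rw [b, ← k]
        intro h
        exact hxz (d.2 ⟨fun _ => h, fun _ => hpx⟩)
      · exact (key x z hx hz hxz hwz).1 hpx
    · by_cases hxz : ∃ x z, Below S x y ∧ Below S z y ∧ ¬ S y x z
      · obtain ⟨x, z, hx, hz, hxz⟩ := hxz
        refine ⟨(P y x ↔ (P z x ↔ f z)), fun h => (hw h).elim, ?_⟩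
        have cross : ∀ a b c, S y a a → S y b b → S y c c → ¬ S y a b → ¬ S y a c →
            ((P a b ↔ f a) ↔ (P a c ↔ f a)) := by
          intro a b c ha hb hc hab hac
          have hbc : S y b c := by
            rcases hS.two_sides ha hb hc with h | h | h
            · exact (hab h).elim
            · exact h
            · exact (hac h).elim
          exact (hL f _ _ _ (hinc ha hb hab).2 (hinc ha hc hac).2).1
            ((hS.split a hbc).resolve_left hab)
        intro a b ha hb hab hpa
        have d1 := hP y x z hx.1 hz.1
        have d2 := hP y a b ha.1 hb.1
        have d3 := hP y x a hx.1 ha.1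
        have d4 := hP y x b hx.1 hb.1
        have bxz := (hf _ _ (hinc hx.1 hz.1 hxz)).2
        have bab := (hf _ _ (hinc ha.1 hb.1 hab)).2
        dsimp only at bxz bab
        by_cases hxa : S y x a
        · have hxb : ¬ S y x b := fun h => hab (hS.trans (hS.symm hxa) h)
          have bxb := (hf _ _ (hinc hx.1 hb.1 hxb)).2
          dsimp only at bxb
          have c1 := cross x z b hx.1 hz.1 hb.1 hxz hxb
          have c2 := cross b x a hb.1 hx.1 ha.1 (fun h => hxb (hS.symm h))
            (fun h => hab (hS.symm h))
          clear cross hL hinc hP hf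
          grind
        · have bxa := (hf _ _ (hinc hx.1 ha.1 hxa)).2
          dsimp only at bxa
          have c1 := cross x z a hx.1 hz.1 ha.1 hxz hxa
          have c2 := cross a x b ha.1 hx.1 hb.1 (fun h => hxa (hS.symm h)) hab
          clear cross hL hinc hP hf
          grind
      · push Not at hxz
        exact ⟨f y, fun _ => rfl, fun x z hx hz h => (h (hxz x z hx hz)).elim⟩
  choose g hg1 hg2 using hg
  refine ⟨fun y a => (P y a ↔ g y), hL g, ?_, ?_⟩
  · intro x y hxy
    have := (hf _ _ hxy).2
    dsimp only at this
    rwa [← hg1 x ⟨y, hxy⟩, ← hg1 y ⟨x, hxy.symm⟩] at this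
  · intro x y z hx hz hxz hn h
    have := hg2 y x z hx hz hn h
    rwa [← hg1 z ⟨x, hxz.symm⟩] at this

/-- Of three distinct points, either two are on the same side of the third, or two incomparable
ones are on opposite sides of the third and below it. -/
theorem same_side_or_link (hS : SideRel S) {x y z : X} (hxy : x ≠ y) (hyz : y ≠ z)
    (hxz : x ≠ z) :
    (S x y z ∨ S y x z ∨ S z x y) ∨
      (Below S y x ∧ Below S z x ∧ Inc S y z ∧ ¬ S x y z) ∨
      (Below S x y ∧ Below S z y ∧ Inc S x z ∧ ¬ S y x z) ∨
      (Below S x z ∧ Below S y z ∧ Inc S x y ∧ ¬ S z x y) := by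
  have main : ∀ {x y z : X}, Below S x y → y ≠ z → x ≠ z →
      (S x y z ∨ S y x z ∨ S z x y) ∨ (Below S x y ∧ Below S z y ∧ Inc S x z ∧ ¬ S y x z) := by
    intro x y z h hyz hxz
    by_cases hy : S z y y
    · exact .inl (.inr (.inr (hS.down h.2 hy)))
    · have hzy : Below S z y := ⟨(hS.separated hyz).resolve_left hy, hy⟩
      rcases hS.eq_or_inc_or_below x z with h1 | h1 | h1
      · exact (hxz h1).elim
      · by_cases h2 : S y x z
        · exact .inl (.inr (.inl h2))
        · exact .inr ⟨h, hzy, h1, h2⟩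
      · exact .inl (.inr (.inl (hS.same_side_of_below h1 h.1 hzy.1)))
  have symm := fun (a b c : X) => hS.symm (y := a) (a := b) (c := c)
  rcases hS.eq_or_inc_or_below x y with h | h | h | h
  · exact (hxy h).elim
  · rcases hS.eq_or_inc_or_below y z with h' | h' | h' | h'
    · exact (hyz h').elim
    · rcases hS.eq_or_inc_or_below x z with h'' | h'' | h'' | h''
      · exact (hxz h'').elim
      · have := hS.one_middle h.1 h.2 h'.1 h'.2 h''.1 h''.2
        tauto
      · have := main h'' hyz.symm hxy
        have := symm x z y
        have := h.symm
        tauto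
      · have := main h'' hxy hyz.symm
        have := symm z y x
        have := symm x z y
        have := symm y z x
        tauto
    · have := main h' hxz.symm hxy.symm
      have := symm y z x
      have := symm z y x
      have := h.symm
      tauto
    · have := main h' hxy.symm hxz.symm
      have := symm z y x
      have := symm y z x
      have := symm x z y
      have := fun h : Inc S z x => h.symm
      tauto
  · have := main h hyz hxz
    tauto
  · have := main h hxz hyz
    have := symm z y x
    tauto

/-- Points can be linearly ordered so that no point is between two points on one side of it. -/
theorem exists_linearOrder (hS : SideRel S) :
    ∃ le : X → X → Prop, IsLinearOrder X le ∧
      ∀ a b c, le a b → le b c → a ≠ b → b ≠ c → ¬ S b a c := by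
  obtain ⟨L, hL, hI, hlink⟩ := hS.exists_left
  let lt : X → X → Prop := fun x y => (S y x x ∧ L y x) ∨ (¬ S y x x ∧ x ≠ y ∧ ¬ L x y)
  have lt_iff : ∀ {x y}, S y x x → (lt x y ↔ L y x) := by
    intro x y h
    simp only [lt]
    tauto
  have lt_asymm : ∀ {x y}, x ≠ y → (lt x y ↔ ¬ lt y x) := by
    intro x y h
    have h1 := hS.separated h
    have h2 := hI x y
    have h3 := h.symm
    simp only [lt]
    unfold Inc at h2
    tauto
  have lt_irrefl : ∀ x, ¬ lt x x := by
    intro x h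
    have := hS.irrefl x
    simp only [lt] at h
    tauto
  have same : ∀ {a b c}, S b a c → (lt a b ↔ lt c b) := by
    intro a b c h
    rw [lt_iff (hS.left h), lt_iff (hS.right h)]
    exact (hL _ _ _ (hS.left h) (hS.right h)).1 h
  have link : ∀ {x y z}, Below S x y → Below S z y → Inc S x z → ¬ S y x z → lt x y →
      lt x z := by
    intro x y z hx hz hxz hn h
    rw [lt_iff hx.1] at h
    rw [lt_iff hxz.1]
    exact hlink x y z hx hz hxz hn h
  have lt_trans : ∀ {x y z}, lt x y → lt y z → lt x z := by
    intro x y z hxy hyz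
    have n1 : x ≠ y := by rintro rfl; exact lt_irrefl _ hxy
    have n2 : y ≠ z := by rintro rfl; exact lt_irrefl _ hyz
    have n3 : x ≠ z := by rintro rfl; exact (lt_asymm n1).1 hxy hyz
    have a1 := (lt_asymm n1).1 hxy
    have a2 := (lt_asymm n2).1 hyz
    by_contra hcon
    have hzx : lt z x := (lt_asymm n3.symm).2 hcon
    rcases hS.same_side_or_link n1 n2 n3 with (h | h | h) | ⟨h1, h2, h3, h4⟩ |
      ⟨h1, h2, h3, h4⟩ | ⟨h1, h2, h3, h4⟩
    · exact a1 ((same h).2 hzx)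
    · exact a2 ((same h).1 hxy)
    · exact hcon ((same h).2 hyz)
    · exact a2 (link h2 h1 h3.symm (fun h => h4 (hS.symm h)) hzx)
    · exact hcon (link h1 h2 h3 h4 hxy)
    · exact a1 (link h2 h1 h3.symm (fun h => h4 (hS.symm h)) hyz)
  refine ⟨fun x y => x = y ∨ lt x y, ?_, ?_⟩
  · exact
      { refl := fun x => .inl rfl
        trans := by
          rintro x y z (rfl | h) (rfl | h')
          · exact .inl rfl
          · exact .inr h'
          · exact .inr h
          · exact .inr (lt_trans h h')
        antisymm := by
          rintro x y (h | h) (h' | h')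
          · exact h
          · exact h
          · exact h'.symm
          · exact (lt_irrefl _ (lt_trans h h')).elim
        total := by
          intro x y
          by_cases h : x = y
          · exact .inl (.inl h)
          · have := lt_asymm h
            tauto }
  · intro a b c hab hbc h1 h2 h
    have h3 := hab.resolve_left h1
    have h4 := hbc.resolve_left h2
    exact (lt_asymm h2).1 h4 ((same h).1 h3)

end SideRel

namespace SetLocLattice

variable {X : Type u} {𝓜 : Set (Set X)} {sup : Set X → Set X → Set X}

theorem sup_comm (h : SetLocLattice 𝓜 sup) {A B : Set X} (hA : A ∈ 𝓜) (hB : B ∈ 𝓜) :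
    sup A B = sup B A :=
  Set.Subset.antisymm
    (h.sup_least A hA B hB _ (h.sup_mem B hB A hA) (h.subset_sup_right B hB A hA)
      (h.subset_sup_left B hB A hA))
    (h.sup_least B hB A hA _ (h.sup_mem A hA B hB) (h.subset_sup_right A hA B hB)
      (h.subset_sup_left A hA B hB))

/-- `a` and `c` lie in a common member of the family that omits `y`. -/
def SameSide (𝓜 : Set (Set X)) (y a c : X) : Prop := ∃ M ∈ 𝓜, a ∈ M ∧ c ∈ M ∧ y ∉ M

/-- Of three pairwise incomparable members, one is the intersection of its joins with the
other two. -/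
theorem exists_middle (h : SetLocLattice 𝓜 sup) {A B C : Set X} (hA : A ∈ 𝓜) (hB : B ∈ 𝓜)
    (hC : C ∈ 𝓜) (hAB : ¬ A ⊆ B ∧ ¬ B ⊆ A) (hAC : ¬ A ⊆ C ∧ ¬ C ⊆ A)
    (hBC : ¬ B ⊆ C ∧ ¬ C ⊆ B) :
    A = sup A B ∩ sup A C ∨ B = sup A B ∩ sup B C ∨ C = sup A C ∩ sup B C := by
  rcases h.trichotomy A hA B hB C hC with h1 | h1 | h1
  · left
    have := h.incomp B hB A hA C hC hAB.symm hBC hAC h1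
    rwa [h.sup_comm hB hA, h.sup_comm hC hA] at this
  · right; left
    have := h.incomp A hA B hB C hC hAB hAC hBC h1
    rwa [h.sup_comm hC hB] at this
  · right; right
    exact h.incomp A hA C hC B hB hAC hAB hBC.symm h1

theorem sideRel (h : SetLocLattice 𝓜 sup) (hsep : SeparatesPoints 𝓜) :
    SideRel (SameSide 𝓜) where
  irrefl := by
    rintro y ⟨M, _, h1, _, h2⟩
    exact h2 h1
  symm := by
    rintro y a c ⟨M, hM, h1, h2, h3⟩
    exact ⟨M, hM, h2, h1, h3⟩
  left := by
    rintro y a c ⟨M, hM, h1, h2, h3⟩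
    exact ⟨M, hM, h1, h1, h3⟩
  trans := by
    rintro y a b c ⟨M, hM, h1, h2, h3⟩ ⟨N, hN, h4, h5, h6⟩
    refine ⟨M ∪ N, ?_, .inl h1, .inr h5, fun h => h.elim h3 h6⟩
    rw [← h.sup_eq_union M hM N hN ⟨b, h2, h4⟩]
    exact h.sup_mem M hM N hN
  two_sides := by
    rintro y a b c ⟨A, hA, ha, -, hyA⟩ ⟨B, hB, hb, -, hyB⟩ ⟨C, hC, hc, -, hyC⟩
    by_contra! hcon
    obtain ⟨nab, nbc, nac⟩ := hcon
    have yab : y ∈ sup A B := by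
      by_contra hy
      exact nab ⟨_, h.sup_mem A hA B hB, h.subset_sup_left A hA B hB ha,
        h.subset_sup_right A hA B hB hb, hy⟩
    have yac : y ∈ sup A C := by
      by_contra hy
      exact nac ⟨_, h.sup_mem A hA C hC, h.subset_sup_left A hA C hC ha,
        h.subset_sup_right A hA C hC hc, hy⟩
    have ybc : y ∈ sup B C := by
      by_contra hy
      exact nbc ⟨_, h.sup_mem B hB C hC, h.subset_sup_left B hB C hC hb,
        h.subset_sup_right B hB C hC hc, hy⟩
    rcases h.exists_middle hA hB hC
      ⟨fun h => nab ⟨B, hB, h ha, hb, hyB⟩, fun h => nab ⟨A, hA, ha, h hb, hyA⟩⟩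
      ⟨fun h => nac ⟨C, hC, h ha, hc, hyC⟩, fun h => nac ⟨A, hA, ha, h hc, hyA⟩⟩
      ⟨fun h => nbc ⟨C, hC, h hb, hc, hyC⟩, fun h => nbc ⟨B, hB, hb, h hc, hyB⟩⟩
      with e | e | e
    · exact hyA (e ▸ ⟨yab, yac⟩)
    · exact hyB (e ▸ ⟨yab, ybc⟩)
    · exact hyC (e ▸ ⟨yac, ybc⟩)
  separated := by
    intro x y hxy
    obtain ⟨M, hM, ⟨h1, h2⟩ | ⟨h1, h2⟩⟩ := hsep x y hxy
    · exact .inl ⟨M, hM, h1, h1, h2⟩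
    · exact .inr ⟨M, hM, h2, h2, h1⟩
  down := by
    rintro x y z c hxy ⟨M, hM, h1, h2, h3⟩
    refine ⟨M, hM, ?_, h2, h3⟩
    by_contra hx
    exact hxy ⟨M, hM, h1, h1, hx⟩
  split := by
    rintro y a c x ⟨M, hM, h1, h2, h3⟩
    by_cases hx : x ∈ M
    · exact .inl ⟨M, hM, hx, h1, h3⟩
    · exact .inr ⟨M, hM, h1, h2, hx⟩
  not_all := by
    rintro x y z ⟨C, hC, yC, zC, xC⟩ ⟨A, hA, xA, zA, yA⟩ ⟨B, hB, xB, yB, zB⟩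
    rcases h.exists_middle hA hB hC ⟨fun h => zB (h zA), fun h => yA (h yB)⟩
      ⟨fun h => xC (h xA), fun h => yA (h yC)⟩ ⟨fun h => xC (h xB), fun h => zB (h zC)⟩
      with e | e | e
    · exact yA (e ▸ ⟨h.subset_sup_right A hA B hB yB, h.subset_sup_right A hA C hC yC⟩)
    · exact zB (e ▸ ⟨h.subset_sup_left A hA B hB zA, h.subset_sup_right B hB C hC zC⟩)
    · exact xC (e ▸ ⟨h.subset_sup_left A hA C hC xA, h.subset_sup_left B hB C hC xB⟩)
  one_middle := by
    rintro x y z ⟨A₁, hA₁, xA₁, -, yA₁⟩ ⟨B₁, hB₁, yB₁, -, xB₁⟩ ⟨B₂, hB₂, yB₂, -, zB₂⟩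
      ⟨C₁, hC₁, zC₁, -, yC₁⟩ ⟨A₂, hA₂, xA₂, -, zA₂⟩ ⟨C₂, hC₂, zC₂, -, xC₂⟩ hy
    by_contra hx
    obtain ⟨A, hA, xA, yA, zA⟩ : ∃ A ∈ 𝓜, x ∈ A ∧ y ∉ A ∧ z ∉ A :=
      ⟨_, h.inter_mem A₁ hA₁ A₂ hA₂, ⟨xA₁, xA₂⟩, fun h => yA₁ h.1, fun h => zA₂ h.2⟩
    obtain ⟨B, hB, yB, xB, zB⟩ : ∃ B ∈ 𝓜, y ∈ B ∧ x ∉ B ∧ z ∉ B :=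
      ⟨_, h.inter_mem B₁ hB₁ B₂ hB₂, ⟨yB₁, yB₂⟩, fun h => xB₁ h.1, fun h => zB₂ h.2⟩
    obtain ⟨C, hC, zC, yC, xC⟩ : ∃ C ∈ 𝓜, z ∈ C ∧ y ∉ C ∧ x ∉ C :=
      ⟨_, h.inter_mem C₁ hC₁ C₂ hC₂, ⟨zC₁, zC₂⟩, fun h => yC₁ h.1, fun h => xC₂ h.2⟩
    have yac : y ∈ sup A C := by
      by_contra hn
      exact hy ⟨_, h.sup_mem A hA C hC, h.subset_sup_left A hA C hC xA,
        h.subset_sup_right A hA C hC zC, hn⟩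
    have xbc : x ∈ sup B C := by
      by_contra hn
      exact hx ⟨_, h.sup_mem B hB C hC, h.subset_sup_left B hB C hC yB,
        h.subset_sup_right B hB C hC zC, hn⟩
    rcases h.exists_middle hA hB hC ⟨fun h => xB (h xA), fun h => yA (h yB)⟩
      ⟨fun h => xC (h xA), fun h => zA (h zC)⟩ ⟨fun h => yC (h yB), fun h => zB (h zC)⟩
      with e | e | e
    · exact yA (e ▸ ⟨h.subset_sup_right A hA B hB yB, yac⟩)
    · exact xB (e ▸ ⟨h.subset_sup_left A hA B hB xA, xbc⟩)
    · exact xC (e ▸ ⟨h.subset_sup_left A hA C hC xA, xbc⟩)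

end SetLocLattice

theorem loc_lattice_of_sets_orderable {X : Type u} (𝓜 : Set (Set X))
    (sup : Set X → Set X → Set X) (h : SetLocLattice 𝓜 sup)
    (hsep : SeparatesPoints 𝓜) :
    ∃ le : X → X → Prop, IsLinearOrder X le ∧ ∀ M ∈ 𝓜, RelConvex le M := by
  obtain ⟨le, hle, hS⟩ := (h.sideRel hsep).exists_linearOrder
  refine ⟨le, hle, fun M hM a b c ha hc hab hbc => ?_⟩
  by_contra hb
  exact hS a b c hab hbc (fun e => hb (e ▸ ha)) (fun e => hb (e ▸ hc)) ⟨M, hM, ha, hc, hb⟩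
end

section
/- Let 𝓜 be a loc-lattice of subsets of a set X and let A, B, C ∈ 𝓜 be nonempty and pairwise incomparable under ⊆. Then exactly one of the three relations A ⊆ B ∨ C, B ⊆ A ∨ C, C ⊆ A ∨ B holds; in particular, if A ⊆ B ∨ C and B ⊆ A ∨ C both held then A ⊆ B, contradicting incomparability. -/
universe u

namespace SetLocLattice

variable {X : Type u} {𝓜 : Set (Set X)} {sup : Set X → Set X → Set X}

/-- Of three pairwise incomparable members, two distinct ones cannot both lie below the join
of the other two. -/
theorem not_subset_sup_of_subset_sup (h : SetLocLattice 𝓜 sup) {A B C : Set X}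
    (hA : A ∈ 𝓜) (hB : B ∈ 𝓜) (hC : C ∈ 𝓜)
    (hAB : ¬ A ⊆ B ∧ ¬ B ⊆ A) (hAC : ¬ A ⊆ C ∧ ¬ C ⊆ A) (hBC : ¬ B ⊆ C ∧ ¬ C ⊆ B)
    (h₁ : A ⊆ sup B C) : ¬ B ⊆ sup A C := by
  intro h₂
  have key := h.incomp B hB A hA C hC hAB.symm hBC hAC h₁
  rw [h.sup_comm hA hC] at h₂
  apply hAB.2
  rw [key]
  exact Set.subset_inter (h.subset_sup_left B hB A hA) h₂

end SetLocLattice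

theorem exactly_one_of_three {X : Type u} (𝓜 : Set (Set X))
    (sup : Set X → Set X → Set X) (h : SetLocLattice 𝓜 sup)
    {A B C : Set X} (hA : A ∈ 𝓜) (hB : B ∈ 𝓜) (hC : C ∈ 𝓜)
    (hAne : A.Nonempty) (hBne : B.Nonempty) (hCne : C.Nonempty)
    (hAB : ¬ A ⊆ B ∧ ¬ B ⊆ A) (hAC : ¬ A ⊆ C ∧ ¬ C ⊆ A) (hBC : ¬ B ⊆ C ∧ ¬ C ⊆ B) :
    ((A ⊆ sup B C ∧ ¬ B ⊆ sup A C ∧ ¬ C ⊆ sup A B) ∨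
     (B ⊆ sup A C ∧ ¬ A ⊆ sup B C ∧ ¬ C ⊆ sup A B) ∨
     (C ⊆ sup A B ∧ ¬ A ⊆ sup B C ∧ ¬ B ⊆ sup A C)) ∧
    (A ⊆ sup B C → B ⊆ sup A C → A ⊆ B) := by
  have nAB := h.not_subset_sup_of_subset_sup hA hB hC hAB hAC hBC
  have nAC := h.not_subset_sup_of_subset_sup hA hC hB hAC hAB hBC.symm
  have nBC := h.not_subset_sup_of_subset_sup hB hC hA hBC hAB.symm hAC.symm
  have tri := h.trichotomy A hA B hB C hC
  rw [h.sup_comm hC hB] at nAC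
  rw [h.sup_comm hC hA, h.sup_comm hB hA] at nBC
  tauto
end

section
/- Let 𝓜 be a loc-lattice of subsets of a set X and let A, B, C ∈ 𝓜 be nonempty and pairwise disjoint. If B ∩ (A ∨ C) ≠ ∅ then B ⊆ A ∨ C. -/
universe u

theorem not_subset_and_not_subset_of_inter_eq_empty {X : Type u} {S T : Set X}
    (hS : S.Nonempty) (hT : T.Nonempty) (hST : S ∩ T = ∅) : ¬ S ⊆ T ∧ ¬ T ⊆ S := by
  have hd := Set.disjoint_iff_inter_eq_empty.mpr hST
  exact ⟨fun hsub => hS.ne_empty (hd.eq_bot_of_le hsub),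
    fun hsub => hT.ne_empty (hd.symm.eq_bot_of_le hsub)⟩

theorem SetLocLattice.sup_subset_sup_comm {X : Type u} {𝓜 : Set (Set X)}
    {sup : Set X → Set X → Set X} (h : SetLocLattice 𝓜 sup) {S T : Set X}
    (hS : S ∈ 𝓜) (hT : T ∈ 𝓜) : sup S T ⊆ sup T S :=
  h.sup_least S hS T hT _ (h.sup_mem T hT S hS)
    (h.subset_sup_right T hT S hS) (h.subset_sup_left T hT S hS)

theorem disjoint_meets_sup_subset {X : Type u} (𝓜 : Set (Set X))
    (sup : Set X → Set X → Set X) (h : SetLocLattice 𝓜 sup)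
    {A B C : Set X} (hA : A ∈ 𝓜) (hB : B ∈ 𝓜) (hC : C ∈ 𝓜)
    (hAne : A.Nonempty) (hBne : B.Nonempty) (hCne : C.Nonempty)
    (hABd : A ∩ B = ∅) (hACd : A ∩ C = ∅) (hBCd : B ∩ C = ∅)
    (hmeet : (B ∩ sup A C).Nonempty) :
    B ⊆ sup A C := by
  obtain ⟨x, hxB, hxAC⟩ := hmeet
  have hAB := not_subset_and_not_subset_of_inter_eq_empty hAne hBne hABd
  have hAC := not_subset_and_not_subset_of_inter_eq_empty hAne hCne hACd
  have hBC := not_subset_and_not_subset_of_inter_eq_empty hBne hCne hBCd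
  rcases h.trichotomy A hA B hB C hC with hsub | hsub | hsub
  · have hxA : x ∈ A := by
      rw [h.incomp B hB A hA C hC hAB.symm hBC hAC hsub]
      exact ⟨h.subset_sup_left B hB A hA hxB, h.sup_subset_sup_comm hA hC hxAC⟩
    exact (Set.eq_empty_iff_forall_notMem.mp hABd x ⟨hxA, hxB⟩).elim
  · exact hsub
  · have hxC : x ∈ C := by
      rw [h.incomp A hA C hC B hB hAC hAB hBC.symm hsub]
      exact ⟨hxAC, h.subset_sup_left B hB C hC hxB⟩
    exact (Set.eq_empty_iff_forall_notMem.mp hBCd x ⟨hxB, hxC⟩).elim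
end

section
/- Let 𝓜 be a loc-lattice of subsets of a set X and let A, B, C ∈ 𝓜 be nonempty. If A ∩ C ≠ ∅ and B ∩ C ≠ ∅ then (A ∨ B) \ (A ∪ B) ⊆ C. -/
universe u

theorem sup_diff_union_subset {X : Type u} (𝓜 : Set (Set X))
    (sup : Set X → Set X → Set X) (h : SetLocLattice 𝓜 sup)
    {A B C : Set X} (hA : A ∈ 𝓜) (hB : B ∈ 𝓜) (hC : C ∈ 𝓜)
    (hAne : A.Nonempty) (hBne : B.Nonempty) (hCne : C.Nonempty)
    (hAC : (A ∩ C).Nonempty) (hBC : (B ∩ C).Nonempty) :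
    sup A B \ (A ∪ B) ⊆ C := by
  have hAC' := h.sup_eq_union A hA C hC hAC
  have hBC' := h.sup_eq_union B hB C hC hBC
  have memAC : A ∪ C ∈ 𝓜 := hAC' ▸ h.sup_mem A hA C hC
  have memBC : B ∪ C ∈ 𝓜 := hBC' ▸ h.sup_mem B hB C hC
  have hne : ((A ∪ C) ∩ (B ∪ C)).Nonempty :=
    hCne.mono fun _ hx => ⟨Or.inr hx, Or.inr hx⟩
  have mem : (A ∪ C) ∪ (B ∪ C) ∈ 𝓜 :=
    h.sup_eq_union _ memAC _ memBC hne ▸ h.sup_mem _ memAC _ memBC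
  rintro x ⟨hx, hn⟩
  have hx' := h.sup_least A hA B hB _ mem
    (fun _ hy => Or.inl (Or.inl hy)) (fun _ hy => Or.inr (Or.inl hy)) hx
  rcases hx' with (hx | hx) | (hx | hx)
  · exact absurd (Or.inl hx) hn
  · exact hx
  · exact absurd (Or.inr hx) hn
  · exact hx
end

section
/- Let 𝓜 be a loc-lattice of subsets of a set X and let A, B, C ∈ 𝓜 be nonempty. If C ∩ (A \ B) ≠ ∅ and C ∩ (B \ A) ≠ ∅ then A ∩ B ⊆ C. -/
universe u

theorem inter_subset_of_meets_both_diffs {X : Type u} (𝓜 : Set (Set X))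
    (sup : Set X → Set X → Set X) (h : SetLocLattice 𝓜 sup)
    {A B C : Set X} (hA : A ∈ 𝓜) (hB : B ∈ 𝓜) (hC : C ∈ 𝓜)
    (hAne : A.Nonempty) (hBne : B.Nonempty) (hCne : C.Nonempty)
    (h1 : (C ∩ (A \ B)).Nonempty) (h2 : (C ∩ (B \ A)).Nonempty) :
    A ∩ B ⊆ C := by
  intro p hp
  obtain ⟨a, haC, haA, haB⟩ := h1
  obtain ⟨b, hbC, hbB, hbA⟩ := h2
  by_contra hpC
  have hAB : ¬ A ⊆ B ∧ ¬ B ⊆ A := ⟨fun k => haB (k haA), fun k => hbA (k hbB)⟩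
  have hAC : ¬ A ⊆ C ∧ ¬ C ⊆ A := ⟨fun k => hpC (k hp.1), fun k => hbA (k hbC)⟩
  have hBC : ¬ B ⊆ C ∧ ¬ C ⊆ B := ⟨fun k => hpC (k hp.2), fun k => haB (k haC)⟩
  rcases h.trichotomy A hA B hB C hC with k | k | k
  · have e := h.incomp B hB A hA C hC hAB.symm hBC hAC k
    exact hbA (e ▸ ⟨h.subset_sup_left B hB A hA hbB, h.subset_sup_left C hC A hA hbC⟩)
  · have e := h.incomp A hA B hB C hC hAB hAC hBC k
    exact haB (e ▸ ⟨h.subset_sup_left A hA B hB haA, h.subset_sup_left C hC B hB haC⟩)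
  · have e := h.incomp A hA C hC B hB hAC hAB hBC.symm k
    exact hpC (e ▸ ⟨h.subset_sup_left A hA C hC hp.1, h.subset_sup_left B hB C hC hp.2⟩)
end

section
/- Let 𝓜 be a loc-lattice of subsets of a set X. Then for every a, b, c ∈ X, at least one of (abc)_𝓜, (acb)_𝓜, (bac)_𝓜 holds. -/
universe u

/-- If `B` lies below the join of `A` and `C`, and each of `A`, `B`, `C` contains exactly two of
the points `a`, `b`, `c`, then the loc-lattice conditions are contradictory. -/
theorem SetLocLattice.not_subset_sup {X : Type u} {𝓜 : Set (Set X)}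
    {sup : Set X → Set X → Set X} (h : SetLocLattice 𝓜 sup) {A B C : Set X}
    (hA : A ∈ 𝓜) (hB : B ∈ 𝓜) (hC : C ∈ 𝓜) {a b c : X}
    (haA : a ∉ A) (hbA : b ∈ A) (hcA : c ∈ A)
    (haB : a ∈ B) (hbB : b ∉ B) (hcB : c ∈ B)
    (haC : a ∈ C) (hbC : b ∈ C) (hcC : c ∉ C) : ¬ B ⊆ sup A C := by
  intro hsub
  have heq := h.incomp A hA B hB C hC
    ⟨fun hs => hbB (hs hbA), fun hs => haA (hs haB)⟩
    ⟨fun hs => hcC (hs hcA), fun hs => haA (hs haC)⟩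
    ⟨fun hs => hcC (hs hcB), fun hs => hbB (hs hbC)⟩ hsub
  apply hbB
  rw [heq]
  exact ⟨h.subset_sup_left A hA B hB hbA, h.subset_sup_left C hC B hB hbC⟩

theorem betweenness_trichotomy {X : Type u} (𝓜 : Set (Set X))
    (sup : Set X → Set X → Set X) (h : SetLocLattice 𝓜 sup) (a b c : X) :
    MBtw 𝓜 a b c ∨ MBtw 𝓜 a c b ∨ MBtw 𝓜 b a c := by
  by_contra hcon
  simp only [MBtw, not_or, not_forall] at hcon
  obtain ⟨⟨B, hB, haB, hcB, hbB⟩, ⟨C, hC, haC, hbC, hcC⟩, ⟨A, hA, hbA, hcA, haA⟩⟩ := hcon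
  rcases h.trichotomy A hA B hB C hC with hs | hs | hs
  · exact h.not_subset_sup hB hA hC hbB haB hcB hbA haA hcA hbC haC hcC hs
  · exact h.not_subset_sup hA hB hC haA hbA hcA haB hbB hcB haC hbC hcC hs
  · exact h.not_subset_sup hA hC hB haA hcA hbA haC hcC hbC haB hcB hbB hs
end

section
/- Let 𝓜 be a loc-lattice of subsets of a set X, let a, b, c be three distinct points of X which are pairwise completely separated by 𝓜, and let (A, B, C) ∈ 𝓜³ be a representative family for (a, b, c). Then (abc)_𝓜 holds if and only if B ⊆ A ∨ C. -/
universe u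

/-- If `B ⊆ A ∨ C` for pairwise incomparable members of a loc-lattice, then `A ∨ B` and
`C ∨ B` meet only inside `B`. -/
theorem SetLocLattice.mem_of_mem_sup {X : Type u} {𝓜 : Set (Set X)}
    {sup : Set X → Set X → Set X} (h : SetLocLattice 𝓜 sup) {A B C : Set X}
    (hA : A ∈ 𝓜) (hB : B ∈ 𝓜) (hC : C ∈ 𝓜) (hAB : ¬ A ⊆ B ∧ ¬ B ⊆ A)
    (hAC : ¬ A ⊆ C ∧ ¬ C ⊆ A) (hBC : ¬ B ⊆ C ∧ ¬ C ⊆ B) (hsub : B ⊆ sup A C) {x : X}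
    (hx₁ : x ∈ sup A B) (hx₂ : x ∈ sup C B) : x ∈ B := by
  rw [h.incomp A hA B hB C hC hAB hAC hBC hsub]
  exact ⟨hx₁, hx₂⟩

theorem SetLocLattice.sup_comm_s11 {X : Type u} {𝓜 : Set (Set X)}
    {sup : Set X → Set X → Set X} (h : SetLocLattice 𝓜 sup) {A B : Set X}
    (hA : A ∈ 𝓜) (hB : B ∈ 𝓜) : sup A B = sup B A :=
  Set.Subset.antisymm
    (h.sup_least A hA B hB _ (h.sup_mem B hB A hA) (h.subset_sup_right B hB A hA)
      (h.subset_sup_left B hB A hA))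
    (h.sup_least B hB A hA _ (h.sup_mem A hA B hB) (h.subset_sup_right A hA B hB)
      (h.subset_sup_left A hA B hB))

theorem SetLocLattice.sup_mono {X : Type u} {𝓜 : Set (Set X)}
    {sup : Set X → Set X → Set X} (h : SetLocLattice 𝓜 sup) {A A' B B' : Set X}
    (hA : A ∈ 𝓜) (hA' : A' ∈ 𝓜) (hB : B ∈ 𝓜) (hB' : B' ∈ 𝓜) (hAA' : A ⊆ A')
    (hBB' : B ⊆ B') : sup A B ⊆ sup A' B' :=
  h.sup_least A hA B hB _ (h.sup_mem A' hA' B' hB')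
    (hAA'.trans (h.subset_sup_left A' hA' B' hB'))
    (hBB'.trans (h.subset_sup_right A' hA' B' hB'))

theorem betweenness_iff_sup {X : Type u} (𝓜 : Set (Set X))
    (sup : Set X → Set X → Set X) (h : SetLocLattice 𝓜 sup)
    {a b c : X} (hab : a ≠ b) (hac : a ≠ c) (hbc : b ≠ c)
    (sab : CompSeparated 𝓜 a b) (sac : CompSeparated 𝓜 a c) (sbc : CompSeparated 𝓜 b c)
    {A B C : Set X} (hA : A ∈ 𝓜) (hB : B ∈ 𝓜) (hC : C ∈ 𝓜)
    (haA : a ∈ A) (hbA : b ∉ A) (hcA : c ∉ A)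
    (hbB : b ∈ B) (haB : a ∉ B) (hcB : c ∉ B)
    (hcC : c ∈ C) (haC : a ∉ C) (hbC : b ∉ C) :
    MBtw 𝓜 a b c ↔ B ⊆ sup A C := by
  have incAB : ¬ A ⊆ B ∧ ¬ B ⊆ A := ⟨fun H => haB (H haA), fun H => hbA (H hbB)⟩
  have incAC : ¬ A ⊆ C ∧ ¬ C ⊆ A := ⟨fun H => haC (H haA), fun H => hcA (H hcC)⟩
  have incBC : ¬ B ⊆ C ∧ ¬ C ⊆ B := ⟨fun H => hbC (H hbB), fun H => hcB (H hcC)⟩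
  constructor
  · intro hbtw
    have hb : b ∈ sup A C := hbtw _ (h.sup_mem A hA C hC)
      (h.subset_sup_left A hA C hC haA) (h.subset_sup_right A hA C hC hcC)
    rcases h.trichotomy A hA B hB C hC with H | H | H
    · exact absurd (h.mem_of_mem_sup hB hA hC incAB.symm incBC incAC H
        (h.subset_sup_left B hB A hA hbB) (h.sup_comm_s11 hA hC ▸ hb)) hbA
    · exact H
    · exact absurd (h.mem_of_mem_sup hA hC hB incAC incAB incBC.symm H hb
        (h.subset_sup_left B hB C hC hbB)) hbC
  · intro hsub M hM haM hcM
    have hA' := h.inter_mem A hA M hM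
    have hC' := h.inter_mem C hC M hM
    rcases h.trichotomy _ hA' B hB _ hC' with H | H | H
    · have ha : a ∈ sup C B := h.sup_comm_s11 hB hC ▸
        h.sup_mono hB hB hC' hC subset_rfl Set.inter_subset_left (H ⟨haA, haM⟩)
      exact absurd (h.mem_of_mem_sup hA hB hC incAB incAC incBC hsub
        (h.subset_sup_left A hA B hB haA) ha) haB
    · exact h.sup_least _ hA' _ hC' M hM Set.inter_subset_right Set.inter_subset_right (H hbB)
    · have hc : c ∈ sup A B :=
        h.sup_mono hA' hA hB hB Set.inter_subset_left subset_rfl (H ⟨hcC, hcM⟩)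
      exact absurd (h.mem_of_mem_sup hA hB hC incAB incAC incBC hsub hc
        (h.subset_sup_left C hC B hB hcC)) hcB
end

section
/- Let 𝓜 be a loc-lattice of subsets of a set X, let a, b, c be three distinct points of X which are pairwise completely separated by 𝓜, and let (A, B, C) ∈ 𝓜³ be a representative family for (a, b, c). If B ⊆ A ∨ C then A ∩ C = ∅, a ∉ B ∨ C, and c ∉ A ∨ B. -/
universe u

theorem middle_sup_consequences {X : Type u} (𝓜 : Set (Set X))
    (sup : Set X → Set X → Set X) (h : SetLocLattice 𝓜 sup)
    {a b c : X} (hab : a ≠ b) (hac : a ≠ c) (hbc : b ≠ c)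
    (sab : CompSeparated 𝓜 a b) (sac : CompSeparated 𝓜 a c) (sbc : CompSeparated 𝓜 b c)
    {A B C : Set X} (hA : A ∈ 𝓜) (hB : B ∈ 𝓜) (hC : C ∈ 𝓜)
    (haA : a ∈ A) (hbA : b ∉ A) (hcA : c ∉ A)
    (hbB : b ∈ B) (haB : a ∉ B) (hcB : c ∉ B)
    (hcC : c ∈ C) (haC : a ∉ C) (hbC : b ∉ C)
    (hBAC : B ⊆ sup A C) :
    A ∩ C = ∅ ∧ a ∉ sup B C ∧ c ∉ sup A B := by
  have hmid : B = sup A B ∩ sup C B :=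
    h.incomp A hA B hB C hC ⟨fun k => haB (k haA), fun k => hbA (k hbB)⟩
      ⟨fun k => haC (k haA), fun k => hcA (k hcC)⟩
      ⟨fun k => hbC (k hbB), fun k => hcB (k hcC)⟩ hBAC
  refine ⟨?_, fun ha => haB ?_, fun hc => hcB ?_⟩
  · by_contra hne
    have hb := hBAC hbB
    rw [h.sup_eq_union A hA C hC (Set.nonempty_iff_ne_empty.mpr hne)] at hb
    exact hb.elim hbA hbC
  · rw [hmid]
    exact ⟨h.subset_sup_left A hA B hB haA,
      h.sup_least B hB C hC _ (h.sup_mem C hC B hB) (h.subset_sup_right C hC B hB)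
        (h.subset_sup_left C hC B hB) ha⟩
  · rw [hmid]
    exact ⟨hc, h.subset_sup_left C hC B hB hcC⟩
end

section
/- Let 𝓜 be a loc-lattice of subsets of a set X which completely separates X. Then 𝓜 totally separates X; that is, for all distinct a, b ∈ X there exist A, B ∈ 𝓜 with a ∈ A, b ∈ B and A ∩ B = ∅. -/
universe u

theorem completely_separates_implies_totally_separates {X : Type u} (𝓜 : Set (Set X))
    (sup : Set X → Set X → Set X) (h : SetLocLattice 𝓜 sup)
    (hcs : CompletelySeparates 𝓜) :
    ∀ a b : X, a ≠ b → ∃ A ∈ 𝓜, ∃ B ∈ 𝓜, a ∈ A ∧ b ∈ B ∧ A ∩ B = ∅ := by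
  intro a b hab
  obtain ⟨A, hA, B, hB, haA, hbA, hbB, haB⟩ := hcs a b hab
  by_cases hAB : A ∩ B = ∅
  · exact ⟨A, hA, B, hB, haA, hbB, hAB⟩
  obtain ⟨c, hcA, hcB⟩ := Set.nonempty_iff_ne_empty.2 hAB
  obtain ⟨C', hC', -, -, haC', hcC', -, -⟩ := hcs a c (ne_of_mem_of_not_mem hcB haB).symm
  obtain ⟨E', hE', -, -, hbE', hcE', -, -⟩ := hcs b c (ne_of_mem_of_not_mem hcA hbA).symm
  have hC := h.inter_mem C' hC' A hA
  have hE := h.inter_mem E' hE' B hB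
  have hD := h.inter_mem A hA B hB
  refine ⟨C' ∩ A, hC, E' ∩ B, hE, ⟨haC', haA⟩, ⟨hbE', hbB⟩, ?_⟩
  by_contra hne
  obtain ⟨x, ⟨hxC, hxA⟩, hxE, hxB⟩ := Set.nonempty_iff_ne_empty.2 hne
  have htri := h.trichotomy _ hC _ hE _ hD
  rw [h.sup_eq_union _ hE _ hD ⟨x, ⟨hxE, hxB⟩, hxA, hxB⟩,
    h.sup_eq_union _ hC _ hD ⟨x, ⟨hxC, hxA⟩, hxA, hxB⟩,
    h.sup_eq_union _ hC _ hE ⟨x, ⟨hxC, hxA⟩, hxE, hxB⟩] at htri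
  rcases htri with hs | hs | hs
  · rcases hs ⟨haC', haA⟩ with hx | hx
    · exact haB hx.2
    · exact haB hx.2
  · rcases hs ⟨hbE', hbB⟩ with hx | hx
    · exact hbA hx.2
    · exact hbA hx.1
  · rcases hs ⟨hcA, hcB⟩ with hx | hx
    · exact hcC' hx.1
    · exact hcE' hx.1
end
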